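/- arXiv:0803.3933 — 2 statements merged into one kernel-verified Lean document; each statement's English description precedes it below -/
import Mathlib

section
/- Let q = p^a with p an odd prime, and let K be a k-arc in PG(2,q), k ≥ 4, that is sharply focused on a line l. Then K is contained in a conic, and k divides q+1, q−1 or q. -/
open scoped LinearAlgebra.Projectivization

/-- The projective plane over a field `F`. -/
abbrev PG2 (F : Type*) [Field F] := Projectivization F (Fin 3 → F)

variable {F : Type*} [Field F]

/-- A line of `PG2 F`: the zero set of a nonzero linear form. -/
def IsLine (l : Set (PG2 F)) : Prop :=
  ∃ f : (Fin 3 → F) →ₗ[F] F, f ≠ 0 ∧ l = {P : PG2 F | f P.rep = 0}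

/-- Three points of `PG2 F` are collinear if some line contains them all. -/
def Collinear3 (A B C : PG2 F) : Prop :=
  ∃ l : Set (PG2 F), IsLine l ∧ A ∈ l ∧ B ∈ l ∧ C ∈ l

/-- An arc: a set of points no three of which are collinear, i.e. every line
meets it in at most two points. -/
def IsArc (K : Set (PG2 F)) : Prop :=
  ∀ l : Set (PG2 F), IsLine l → (K ∩ l).ncard ≤ 2

/-- A secant (chord) of `K`: a line containing at least two points of `K`. -/
def IsSecant (K l : Set (PG2 F)) : Prop :=
  IsLine l ∧ 2 ≤ (K ∩ l).ncard

/-- A blocking set of the secants of `K`: a set of points disjoint from `K`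
meeting every secant of `K`. -/
def IsBlockingSet (K B : Set (PG2 F)) : Prop :=
  B ∩ K = ∅ ∧ ∀ l : Set (PG2 F), IsSecant K l → (B ∩ l).Nonempty

/-- The focus set of `K` on `l`: the points of `l` lying on some secant of `K`. -/
def FocusSet (K l : Set (PG2 F)) : Set (PG2 F) :=
  {P : PG2 F | P ∈ l ∧ ∃ m : Set (PG2 F), IsSecant K m ∧ P ∈ m}

/-- `K` is hyperfocused on the exterior line `l` if the secants of `K` meet `l`
in exactly `|K| - 1` points. -/
def Hyperfocused (K l : Set (PG2 F)) : Prop :=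
  IsLine l ∧ K ∩ l = ∅ ∧ (FocusSet K l).ncard = K.ncard - 1

/-- `K` is sharply focused on the exterior line `l` if the secants of `K` meet `l`
in exactly `|K|` points. -/
def SharplyFocused (K l : Set (PG2 F)) : Prop :=
  IsLine l ∧ K ∩ l = ∅ ∧ (FocusSet K l).ncard = K.ncard

/-- A conic: the zero set of an irreducible homogeneous quadratic form. -/
def IsConic (C : Set (PG2 F)) : Prop :=
  ∃ Q : MvPolynomial (Fin 3) F, Q.IsHomogeneous 2 ∧ Irreducible Q ∧
    C = {P : PG2 F | MvPolynomial.eval P.rep Q = 0}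

/-- A tangent line to a point set `C`: a line meeting `C` in exactly one point. -/
def IsTangentLine (C l : Set (PG2 F)) : Prop :=
  IsLine l ∧ (C ∩ l).ncard = 1

/-- A projectivity of `PG2 F`: a map induced by a linear automorphism. -/
def IsProjectivity (φ : PG2 F → PG2 F) : Prop :=
  ∃ g : (Fin 3 → F) ≃ₗ[F] (Fin 3 → F),
    ∀ P : PG2 F, φ P = Projectivization.map g.toLinearMap g.injective P

lemma mk3_ne_zero {a b c : F} (h : a ≠ 0 ∨ b ≠ 0 ∨ c ≠ 0) :
    (![a, b, c] : Fin 3 → F) ≠ 0 := by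
  intro hv
  rcases h with h | h | h
  · exact h (by simpa using congrFun hv 0)
  · exact h (by simpa using congrFun hv 1)
  · exact h (by simpa using congrFun hv 2)

/-- The point of `PG2 F` with homogeneous coordinates `(a, b, c)`. -/
def pt (a b c : F) (h : (![a, b, c] : Fin 3 → F) ≠ 0) : PG2 F :=
  Projectivization.mk F ![a, b, c] h

/-- The linear automorphism `(X₁, X₂, X₃) ↦ (X₁ + a₁·X₃, X₂ + a₂·X₃, X₃)`. -/
def tEquiv (A : F × F) : (Fin 3 → F) ≃ₗ[F] (Fin 3 → F) where
  toFun v := ![v 0 + A.1 * v 2, v 1 + A.2 * v 2, v 2]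
  invFun v := ![v 0 - A.1 * v 2, v 1 - A.2 * v 2, v 2]
  left_inv v := by funext i; fin_cases i <;> simp
  right_inv v := by funext i; fin_cases i <;> simp
  map_add' u v := by funext i; fin_cases i <;> simp <;> ring
  map_smul' c v := by funext i; fin_cases i <;> simp <;> ring

/-- The projectivity `φ_A` of `PG2 F` induced by `tEquiv A`. -/
def tφ (A : F × F) : PG2 F → PG2 F :=
  Projectivization.map (tEquiv A).toLinearMap (tEquiv A).injective

/-- The orbit `K_G(P)` of a point `P` under the translation group `T_G`. -/
def tOrbit (G : AddSubgroup (F × F)) (P : PG2 F) : Set (PG2 F) :=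
  {Q : PG2 F | ∃ A ∈ G, Q = tφ A P}

/-- A translation arc: an arc which is an orbit `K_G(P)`. -/
def IsTranslationArc (K : Set (PG2 F)) : Prop :=
  IsArc K ∧ ∃ (G : AddSubgroup (F × F)) (P : PG2 F), K = tOrbit G P

/-- The determinant of two vectors of the plane `F × F`. -/
def wedge (u v : F × F) : F := u.1 * v.2 - u.2 * v.1

lemma exists_smul_of_wedge_eq_zero {u v : F × F} (hu : u ≠ 0) (h : wedge u v = 0) :
    ∃ c : F, v = c • u := by
  obtain ⟨a, b⟩ := u
  obtain ⟨x, y⟩ := v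
  simp only [wedge] at h
  by_cases ha : a = 0
  · have hb : b ≠ 0 := by rintro rfl; exact hu (by simp [ha])
    subst ha
    refine ⟨y / b, ?_⟩
    have : x = 0 := by simpa [hb] using h
    ext <;> simp [this, hb]
  · refine ⟨x / a, ?_⟩
    ext
    · simp [ha]
    · simp only [Prod.smul_mk, smul_eq_mul]
      field_simp
      linear_combination h

lemma wedge_eq_zero_trans {u v w : F × F} (hv : v ≠ 0) (h₁ : wedge u v = 0)
    (h₂ : wedge v w = 0) : wedge u w = 0 := by
  obtain ⟨c, rfl⟩ := exists_smul_of_wedge_eq_zero hv h₂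
  simp only [wedge, Prod.smul_fst, Prod.smul_snd, smul_eq_mul] at h₁ ⊢
  linear_combination c * h₁

lemma wedge_comm_eq_zero {u v : F × F} (h : wedge u v = 0) : wedge v u = 0 := by
  simp only [wedge] at h ⊢
  linear_combination -h

/-- A plane arc `S` whose chords have their directions represented in a set `D` of `#S`
pairwise non-parallel vectors. -/
structure IsSharplyFocusedOn (S D : Finset (F × F)) : Prop where
  card_eq : S.card = D.card
  arc : ∀ A ∈ S, ∀ B ∈ S, ∀ C ∈ S, A ≠ B → A ≠ C → B ≠ C → wedge (B - A) (C - A) ≠ 0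
  ne_zero : ∀ d ∈ D, d ≠ 0
  wedge_ne_zero : ∀ d ∈ D, ∀ e ∈ D, d ≠ e → wedge d e ≠ 0
  exists_dir : ∀ A ∈ S, ∀ B ∈ S, A ≠ B → ∃ d ∈ D, wedge d (B - A) = 0

namespace IsSharplyFocusedOn

variable {S D : Finset (F × F)}

lemma eq_of_wedge (h : IsSharplyFocusedOn S D) {d e v : F × F} (hd : d ∈ D) (he : e ∈ D)
    (hv : v ≠ 0) (hdv : wedge d v = 0) (hev : wedge e v = 0) : d = e := by
  by_contra hne
  exact h.wedge_ne_zero d hd e he hne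
    (wedge_eq_zero_trans hv hdv (wedge_comm_eq_zero hev))

/-- For each point `A` of `S` the points of `S` correspond bijectively to the directions in `D`:
a point `B ≠ A` to the direction of the chord `AB`, the point `A` to the direction
missed by the chords through `A`. -/
lemma exists_dirMap (h : IsSharplyFocusedOn S D) {A : F × F} (hA : A ∈ S) :
    ∃ φ : F × F → F × F, Set.BijOn φ S D ∧
      ∀ B ∈ S, B ≠ A → wedge (φ B) (B - A) = 0 := by
  classical
  choose! δ hδD hδ using fun B hB (hne : A ≠ B) => h.exists_dir A hA B hB hne
  have hinj : Set.InjOn δ (S.erase A) := by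
    intro B hB C hC hBC
    simp only [Finset.coe_erase, Set.mem_sdiff, Finset.mem_coe, Set.mem_singleton_iff] at hB hC
    by_contra hne
    have h1 := hδ B hB.1 (Ne.symm hB.2)
    have h2 := hδ C hC.1 (Ne.symm hC.2)
    rw [hBC] at h1
    exact h.arc A hA B hB.1 C hC.1 (Ne.symm hB.2) (Ne.symm hC.2) hne
      (wedge_eq_zero_trans (h.ne_zero _ (hδD C hC.1 (Ne.symm hC.2)))
        (wedge_comm_eq_zero h1) h2)
  have hmaps : (S.erase A).image δ ⊆ D := by
    intro d hd
    obtain ⟨B, hB, rfl⟩ := Finset.mem_image.1 hd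
    exact hδD B (Finset.mem_of_mem_erase hB) (Ne.symm (Finset.ne_of_mem_erase hB))
  have hcard : ((S.erase A).image δ).card < D.card := by
    rw [Finset.card_image_of_injOn hinj, Finset.card_erase_of_mem hA, ← h.card_eq]
    have := Finset.card_pos.2 ⟨A, hA⟩
    omega
  obtain ⟨t, htD, ht⟩ := Finset.exists_mem_notMem_of_card_lt_card hcard
  have hval : ∀ B, B ≠ A → Function.update δ A t B = δ B := fun B hB => by simp [hB]
  have hm : Set.MapsTo (Function.update δ A t) S D := by
    intro B hB
    by_cases hBA : B = A
    · subst hBA; simpa using htD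
    · rw [hval B hBA]; exact hδD B hB (Ne.symm hBA)
  have hi : Set.InjOn (Function.update δ A t) S := by
    intro B hB C hC hBC
    by_cases hBA : B = A <;> by_cases hCA : C = A
    · rw [hBA, hCA]
    · rw [hval C hCA, hBA, Function.update_self] at hBC
      exact absurd (Finset.mem_image.2 ⟨C, Finset.mem_erase.2 ⟨hCA, hC⟩, hBC.symm⟩) ht
    · rw [hval B hBA, hCA, Function.update_self] at hBC
      exact absurd (Finset.mem_image.2 ⟨B, Finset.mem_erase.2 ⟨hBA, hB⟩, hBC⟩) ht
    · rw [hval B hBA, hval C hCA] at hBC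
      exact hinj (by simpa using ⟨hB, hBA⟩) (by simpa using ⟨hC, hCA⟩) hBC
  refine ⟨Function.update δ A t, ⟨hm, hi, ?_⟩, fun B hB hBA => ?_⟩
  · exact Finset.surjOn_of_injOn_of_card_le _ hm hi h.card_eq.ge
  · rw [hval B hBA]; exact hδ B hB (Ne.symm hBA)

end IsSharplyFocusedOn

/-- The position of the line through `A` with direction `v`
in the pencil of lines through the vertex `A` of the triangle `ABC`. -/
def cevaRatio (A B C v : F × F) : F := wedge v (B - A) / wedge v (C - A)

lemma cevaRatio_congr {A B C v w : F × F} (hv : v ≠ 0) (hw : w ≠ 0) (h : wedge v w = 0) :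
    cevaRatio A B C v = cevaRatio A B C w := by
  obtain ⟨c, rfl⟩ := exists_smul_of_wedge_eq_zero hv h
  have hc : c ≠ 0 := by rintro rfl; simp at hw
  have : ∀ u, wedge (c • v) u = c * wedge v u := fun u => by simp [wedge]; ring
  rw [cevaRatio, cevaRatio, this, this, mul_div_mul_left _ _ hc]

lemma cevaRatio_opposite_side {A B C : F × F} (h : wedge (B - A) (C - A) ≠ 0) :
    cevaRatio A B C (C - B) = 1 := by
  have h1 : wedge (C - B) (B - A) = - wedge (B - A) (C - A) := by simp [wedge]; ring
  have h2 : wedge (C - B) (C - A) = - wedge (B - A) (C - A) := by simp [wedge]; ring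
  rw [cevaRatio, h1, h2, div_self (neg_ne_zero.2 h)]

lemma cevaRatio_mul_of_parallel {A B C d : F × F} (h₁ : wedge d (B - A) ≠ 0)
    (h₂ : wedge d (C - A) ≠ 0) (h₃ : wedge d (C - B) ≠ 0) :
    cevaRatio A B C d * cevaRatio B C A d * cevaRatio C A B d = -1 := by
  have e1 : wedge d (A - B) = - wedge d (B - A) := by simp [wedge]; ring
  have e2 : wedge d (A - C) = - wedge d (C - A) := by simp [wedge]; ring
  have e3 : wedge d (B - C) = - wedge d (C - B) := by simp [wedge]; ring
  rw [cevaRatio, cevaRatio, cevaRatio, e1, e2, e3]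
  field_simp

lemma cevaRatio_mul_of_concurrent {A B C X : F × F} (h₁ : wedge (X - A) (B - A) ≠ 0)
    (h₂ : wedge (X - A) (C - A) ≠ 0) (h₃ : wedge (X - B) (C - B) ≠ 0) :
    cevaRatio A B C (X - A) * cevaRatio B C A (X - B) * cevaRatio C A B (X - C) = -1 := by
  have e1 : wedge (X - B) (A - B) = - wedge (X - A) (B - A) := by simp [wedge]; ring
  have e2 : wedge (X - C) (A - C) = - wedge (X - A) (C - A) := by simp [wedge]; ring
  have e3 : wedge (X - C) (B - C) = - wedge (X - B) (C - B) := by simp [wedge]; ring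
  rw [cevaRatio, cevaRatio, cevaRatio, e1, e2, e3]
  field_simp

namespace IsSharplyFocusedOn

variable {S D : Finset (F × F)}

/-- The data of `IsSharplyFocusedOn.exists_dirMap` at all points of `S` at once. -/
def IsDirMap (S D : Finset (F × F)) (φ : F × F → F × F → F × F) : Prop :=
  ∀ A ∈ S, Set.BijOn (φ A) S D ∧ ∀ B ∈ S, B ≠ A → wedge (φ A B) (B - A) = 0

lemma exists_isDirMap (h : IsSharplyFocusedOn S D) : ∃ φ, IsDirMap S D φ := by
  choose! φ hφ using fun A hA => h.exists_dirMap (A := A) hA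
  exact ⟨φ, hφ⟩

variable {φ : F × F → F × F → F × F}

lemma dirMap_comm (h : IsSharplyFocusedOn S D) (hφ : IsDirMap S D φ) {A B : F × F}
    (hA : A ∈ S) (hB : B ∈ S) : φ A B = φ B A := by
  by_cases hAB : A = B
  · rw [hAB]
  refine h.eq_of_wedge ((hφ A hA).1.mapsTo hB) ((hφ B hB).1.mapsTo hA) (sub_ne_zero.2 hAB)
    ?_ ((hφ B hB).2 A hA hAB)
  have := (hφ A hA).2 B hB (Ne.symm hAB)
  simp only [wedge, Prod.fst_sub, Prod.snd_sub] at this ⊢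
  linear_combination -this

lemma wedge_sub_ne_zero (h : IsSharplyFocusedOn S D) (hφ : IsDirMap S D φ) {A B d : F × F}
    (hA : A ∈ S) (hB : B ∈ S) (hBA : B ≠ A) (hd : d ∈ D) (hne : d ≠ φ A B) :
    wedge d (B - A) ≠ 0 := fun h0 =>
  hne (h.eq_of_wedge hd ((hφ A hA).1.mapsTo hB) (sub_ne_zero.2 hBA) h0 ((hφ A hA).2 B hB hBA))

lemma wedge_tangent_ne_zero (h : IsSharplyFocusedOn S D) (hφ : IsDirMap S D φ) {A B : F × F}
    (hA : A ∈ S) (hB : B ∈ S) (hBA : B ≠ A) : wedge (φ A A) (B - A) ≠ 0 :=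
  h.wedge_sub_ne_zero hφ hA hB hBA ((hφ A hA).1.mapsTo hA) fun he =>
    hBA ((hφ A hA).1.injOn hB hA he.symm)

open Classical in
lemma prod_cevaRatio (h : IsSharplyFocusedOn S D) (hφ : IsDirMap S D φ) {A B C : F × F}
    (hA : A ∈ S) (hB : B ∈ S) (hC : C ∈ S) (hAB : A ≠ B) (hAC : A ≠ C) (hBC : B ≠ C) :
    (∏ X ∈ S \ {A, B, C}, cevaRatio A B C (X - A)) * cevaRatio A B C (φ A A) =
      ∏ d ∈ D \ {φ A B, φ B C, φ C A}, cevaRatio A B C d := by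
  have hinj := (hφ A hA).1.injOn
  have hmaps := (hφ A hA).1.mapsTo
  have key : ∏ X ∈ S \ {B, C}, cevaRatio A B C (φ A X) =
      ∏ d ∈ D \ {φ A B, φ A C}, cevaRatio A B C d := by
    refine Finset.prod_nbij (φ A) ?_ ?_ ?_ (fun _ _ => rfl)
    · intro X hX
      simp only [Finset.mem_sdiff, Finset.mem_insert, Finset.mem_singleton, not_or] at hX ⊢
      exact ⟨hmaps hX.1, fun he => hX.2.1 (hinj hX.1 hB he), fun he => hX.2.2 (hinj hX.1 hC he)⟩
    · exact hinj.mono (by simp)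
    · intro d hd
      simp only [Finset.coe_sdiff, Set.mem_sdiff, Finset.mem_coe, Finset.mem_insert,
        Finset.mem_singleton, not_or] at hd
      obtain ⟨X, hX, rfl⟩ := (hφ A hA).1.surjOn hd.1
      refine ⟨X, ?_, rfl⟩
      simp only [Finset.coe_sdiff, Set.mem_sdiff, Finset.mem_coe, Finset.mem_insert,
        Finset.mem_singleton, not_or]
      exact ⟨hX, fun he => hd.2.1 (by rw [he]), fun he => hd.2.2 (by rw [he])⟩
  have hside : φ B C ∈ D := (hφ B hB).1.mapsTo hC
  have hsideBA : φ B C ≠ φ A B := by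
    rw [h.dirMap_comm hφ hA hB]
    exact fun he => hAC ((hφ B hB).1.injOn hC hA he).symm
  have hsideCA : φ B C ≠ φ A C := by
    rw [h.dirMap_comm hφ hA hC, h.dirMap_comm hφ hB hC]
    exact fun he => hAB ((hφ C hC).1.injOn hB hA he).symm
  have hS : S \ {B, C} = insert A (S \ {A, B, C}) := by
    ext X
    simp only [Finset.mem_sdiff, Finset.mem_insert, Finset.mem_singleton]
    by_cases hX : X = A
    · subst hX; simp [hA, hAB, hAC]
    · simp [hX]
  have hD : D \ {φ A B, φ A C} = insert (φ B C) (D \ {φ A B, φ B C, φ C A}) := by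
    rw [h.dirMap_comm hφ hC hA]
    ext X
    simp only [Finset.mem_sdiff, Finset.mem_insert, Finset.mem_singleton]
    by_cases hX : X = φ B C
    · subst hX; simp [hside, hsideBA, hsideCA]
    · simp [hX]
  rw [hS, hD, Finset.prod_insert (by simp), Finset.prod_insert (by simp),
    cevaRatio_congr (h.ne_zero _ hside) (sub_ne_zero.2 hBC.symm) ((hφ B hB).2 C hC hBC.symm),
    cevaRatio_opposite_side (h.arc A hA B hB C hC hAB hAC hBC), one_mul] at key
  rw [← key, mul_comm]
  congr 1
  refine Finset.prod_congr rfl fun X hX => ?_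
  simp only [Finset.mem_sdiff, Finset.mem_insert, Finset.mem_singleton, not_or] at hX
  exact (cevaRatio_congr (h.ne_zero _ (hmaps hX.1)) (sub_ne_zero.2 hX.2.1)
    ((hφ A hA).2 X hX.1 hX.2.1)).symm

/-- Segre's lemma of tangents for sharply focused arcs. -/
lemma prod_tangents (h : IsSharplyFocusedOn S D) (hφ : IsDirMap S D φ) {A B C : F × F}
    (hA : A ∈ S) (hB : B ∈ S) (hC : C ∈ S) (hAB : A ≠ B) (hAC : A ≠ C) (hBC : B ≠ C) :
    cevaRatio A B C (φ A A) * cevaRatio B C A (φ B B) * cevaRatio C A B (φ C C) = 1 := by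
  classical
  have h1 := h.prod_cevaRatio hφ hA hB hC hAB hAC hBC
  have h2 := h.prod_cevaRatio hφ hB hC hA hBC hAB.symm hAC.symm
  have h3 := h.prod_cevaRatio hφ hC hA hB hAC.symm hBC.symm hAB
  have s2 : ({B, C, A} : Finset (F × F)) = {A, B, C} := by ext; simp; tauto
  have s3 : ({C, A, B} : Finset (F × F)) = {A, B, C} := by ext; simp; tauto
  have d2 : ({φ B C, φ C A, φ A B} : Finset (F × F)) = {φ A B, φ B C, φ C A} := by
    ext; simp; tauto
  have d3 : ({φ C A, φ A B, φ B C} : Finset (F × F)) = {φ A B, φ B C, φ C A} := by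
    ext; simp; tauto
  rw [s2, d2] at h2
  rw [s3, d3] at h3
  have hX : (∏ X ∈ S \ {A, B, C}, cevaRatio A B C (X - A)) *
      (∏ X ∈ S \ {A, B, C}, cevaRatio B C A (X - B)) *
      (∏ X ∈ S \ {A, B, C}, cevaRatio C A B (X - C)) = (-1) ^ (S \ {A, B, C}).card := by
    rw [← Finset.prod_mul_distrib, ← Finset.prod_mul_distrib]
    refine Finset.prod_eq_pow_card fun X hX => ?_
    simp only [Finset.mem_sdiff, Finset.mem_insert, Finset.mem_singleton, not_or] at hX
    obtain ⟨hXS, hXA, hXB, hXC⟩ := hX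
    exact cevaRatio_mul_of_concurrent
      (h.arc A hA X hXS B hB (Ne.symm hXA) hAB hXB)
      (h.arc A hA X hXS C hC (Ne.symm hXA) hAC hXC)
      (h.arc B hB X hXS C hC (Ne.symm hXB) hBC hXC)
  have hd : (∏ d ∈ D \ {φ A B, φ B C, φ C A}, cevaRatio A B C d) *
      (∏ d ∈ D \ {φ A B, φ B C, φ C A}, cevaRatio B C A d) *
      (∏ d ∈ D \ {φ A B, φ B C, φ C A}, cevaRatio C A B d) =
        (-1) ^ (D \ {φ A B, φ B C, φ C A}).card := by
    rw [← Finset.prod_mul_distrib, ← Finset.prod_mul_distrib]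
    refine Finset.prod_eq_pow_card fun d hd => ?_
    simp only [Finset.mem_sdiff, Finset.mem_insert, Finset.mem_singleton, not_or] at hd
    obtain ⟨hdD, h1, h2, h3⟩ := hd
    rw [h.dirMap_comm hφ hC hA] at h3
    exact cevaRatio_mul_of_parallel
      (h.wedge_sub_ne_zero hφ hA hB hAB.symm hdD h1)
      (h.wedge_sub_ne_zero hφ hA hC hAC.symm hdD h3)
      (h.wedge_sub_ne_zero hφ hB hC hBC.symm hdD h2)
  have hcard : (S \ {A, B, C}).card = (D \ {φ A B, φ B C, φ C A}).card := by
    have e1 : φ A B ≠ φ B C := by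
      rw [h.dirMap_comm hφ hA hB]; exact fun he => hAC ((hφ B hB).1.injOn hA hC he)
    have e2 : φ A B ≠ φ C A := by
      rw [h.dirMap_comm hφ hC hA]; exact fun he => hBC ((hφ A hA).1.injOn hB hC he)
    have e3 : φ B C ≠ φ C A := by
      rw [h.dirMap_comm hφ hB hC]; exact fun he => hAB ((hφ C hC).1.injOn hB hA he).symm
    have m1 := (hφ A hA).1.mapsTo hB
    have m2 := (hφ B hB).1.mapsTo hC
    have m3 := (hφ C hC).1.mapsTo hA
    rw [Finset.mem_coe] at m1 m2 m3
    rw [Finset.card_sdiff_of_subset (by simp [Finset.insert_subset_iff, hA, hB, hC]),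
      Finset.card_sdiff_of_subset (by simp [Finset.insert_subset_iff, m1, m2, m3]),
      Finset.card_eq_three.2 ⟨A, B, C, hAB, hAC, hBC, rfl⟩,
      Finset.card_eq_three.2 ⟨_, _, _, e1, e2, e3, rfl⟩, h.card_eq]
  rw [← h1, ← h2, ← h3, hcard.symm, ← hX] at hd
  have hX0 : (∏ X ∈ S \ {A, B, C}, cevaRatio A B C (X - A)) *
      (∏ X ∈ S \ {A, B, C}, cevaRatio B C A (X - B)) *
      (∏ X ∈ S \ {A, B, C}, cevaRatio C A B (X - C)) ≠ 0 := by
    rw [hX]; exact pow_ne_zero _ (by simp)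
  refine mul_left_cancel₀ hX0 ?_
  linear_combination hd

end IsSharplyFocusedOn

lemma eq_zero_of_wedge_ne_zero {P Q : F × F} (h : wedge P Q ≠ 0) {p q : F}
    (hP : p * P.1 + q * P.2 = 0) (hQ : p * Q.1 + q * Q.2 = 0) : p = 0 ∧ q = 0 := by
  constructor
  · refine (mul_eq_zero.1 (?_ : p * wedge P Q = 0)).resolve_right h
    simp only [wedge]; linear_combination Q.2 * hP - P.2 * hQ
  · refine (mul_eq_zero.1 (?_ : q * wedge P Q = 0)).resolve_right h
    simp only [wedge]; linear_combination P.1 * hQ - Q.1 * hP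

/-- The symmetric bilinear form with Gram matrix `!![a, b; b, c]`. -/
def polarForm (a b c : F) (u v : F × F) : F :=
  a * u.1 * v.1 + b * (u.1 * v.2 + u.2 * v.1) + c * u.2 * v.2

lemma exists_polarForm {P Q : F × F} (h : wedge P Q ≠ 0) (x y z : F) :
    ∃ a b c : F, polarForm a b c P P = x ∧ polarForm a b c P Q = y ∧
      polarForm a b c Q Q = z := by
  refine ⟨(x * Q.2 ^ 2 - 2 * y * P.2 * Q.2 + z * P.2 ^ 2) / wedge P Q ^ 2,
    (-x * Q.1 * Q.2 + y * (P.1 * Q.2 + P.2 * Q.1) - z * P.1 * P.2) / wedge P Q ^ 2,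
    (x * Q.1 ^ 2 - 2 * y * P.1 * Q.1 + z * P.1 ^ 2) / wedge P Q ^ 2, ?_, ?_, ?_⟩ <;>
  · simp only [polarForm]
    field_simp
    simp only [wedge]
    ring

namespace IsSharplyFocusedOn

variable {S D : Finset (F × F)} {φ : F × F → F × F → F × F}

lemma dirMap_zero (hφ : IsDirMap S D φ) (h0 : 0 ∈ S) (h10 : ((1, 0) : F × F) ∈ D)
    (hy : ∀ P ∈ S, P ≠ 0 → P.2 ≠ 0) : φ 0 0 = (1, 0) := by
  obtain ⟨X, hX, hX1⟩ := (hφ 0 h0).1.surjOn h10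
  by_cases hX0 : X = 0
  · rwa [hX0] at hX1
  · have := (hφ 0 h0).2 X hX hX0
    rw [hX1] at this
    exact absurd (by simpa [wedge] using this) (hy X hX hX0)

/-- The missed direction at `P`, scaled to have wedge product `P.2` with `P`. -/
def tangentForm (φ : F × F → F × F → F × F) (P V : F × F) : F :=
  P.2 / wedge (φ P P) P * wedge (φ P P) V

lemma wedge_tangent_self_ne_zero (h : IsSharplyFocusedOn S D) (hφ : IsDirMap S D φ)
    (h0 : 0 ∈ S) {P : F × F} (hP : P ∈ S) (hP0 : P ≠ 0) : wedge (φ P P) P ≠ 0 := by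
  have := h.wedge_tangent_ne_zero hφ hP h0 hP0.symm
  intro h
  apply this
  simp only [wedge, Prod.fst_sub, Prod.snd_sub, Prod.fst_zero, Prod.snd_zero] at h ⊢
  linear_combination -h

lemma tangentForm_self (h : IsSharplyFocusedOn S D) (hφ : IsDirMap S D φ)
    (h0 : 0 ∈ S) {P : F × F} (hP : P ∈ S) (hP0 : P ≠ 0) : tangentForm φ P P = P.2 :=
  div_mul_cancel₀ _ (h.wedge_tangent_self_ne_zero hφ h0 hP hP0)

lemma tangentForm_symm (h : IsSharplyFocusedOn S D) (hφ : IsDirMap S D φ)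
    (h0 : 0 ∈ S) (h10 : ((1, 0) : F × F) ∈ D) (hy : ∀ P ∈ S, P ≠ 0 → P.2 ≠ 0) {P Q : F × F}
    (hP : P ∈ S) (hP0 : P ≠ 0) (hQ : Q ∈ S) (hQ0 : Q ≠ 0) :
    tangentForm φ P Q + Q.2 = tangentForm φ Q P + P.2 := by
  by_cases hPQ : P = Q
  · rw [hPQ]
  have key := h.prod_tangents hφ h0 hP hQ hP0.symm hQ0.symm hPQ
  rw [dirMap_zero hφ h0 h10 hy] at key
  have hyP := hy P hP hP0
  have hyQ := hy Q hQ hQ0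
  have htP := h.wedge_tangent_self_ne_zero hφ h0 hP hP0
  have htQ := h.wedge_tangent_self_ne_zero hφ h0 hQ hQ0
  have htQP := h.wedge_tangent_ne_zero hφ hQ hP hPQ
  have hsub : ∀ u v w : F × F, wedge u (v - w) = wedge u v - wedge u w := fun u v w => by
    simp only [wedge, Prod.fst_sub, Prod.snd_sub]; ring
  have hneg : ∀ u v : F × F, wedge u (-v) = -wedge u v := fun u v => by
    simp only [wedge, Prod.fst_neg, Prod.snd_neg]; ring
  have h1 : ∀ u : F × F, wedge (1, 0) u = u.2 := fun u => by simp [wedge]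
  simp only [cevaRatio, hsub, hneg, h1, sub_zero, zero_sub] at key htQP
  simp only [tangentForm]
  field_simp at key ⊢
  linear_combination key

lemma tangentForm_eq_of_eq {a b c : F} {P Q R : F × F} (hPQ : wedge P Q ≠ 0)
    (hP : tangentForm φ R P = polarForm a b c R P - P.2)
    (hQ : tangentForm φ R Q = polarForm a b c R Q - Q.2) (V : F × F) :
    tangentForm φ R V = polarForm a b c R V - V.2 := by
  obtain ⟨h1, h2⟩ := eq_zero_of_wedge_ne_zero hPQ
    (p := -(R.2 / wedge (φ R R) R) * (φ R R).2 - (a * R.1 + b * R.2))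
    (q := (R.2 / wedge (φ R R) R) * (φ R R).1 - (b * R.1 + c * R.2) + 1)
    (by
      rw [tangentForm, polarForm] at hP; nth_rw 2 [wedge] at hP
      linear_combination hP)
    (by
      rw [tangentForm, polarForm] at hQ; nth_rw 2 [wedge] at hQ
      linear_combination hQ)
  rw [tangentForm, polarForm]
  nth_rw 2 [wedge]
  linear_combination V.1 * h1 + V.2 * h2

/-- A sharply focused arc lies on a conic whose tangents at the points of the arc have the missed
directions. -/
theorem exists_conic (h : IsSharplyFocusedOn S D) (hφ : IsDirMap S D φ) (h2 : (2 : F) ≠ 0)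
    (h0 : 0 ∈ S) (h10 : ((1, 0) : F × F) ∈ D) (hy : ∀ P ∈ S, P ≠ 0 → P.2 ≠ 0)
    (hk : 4 ≤ S.card) :
    ∃ a b c : F, a ≠ 0 ∧ (∀ P ∈ S, 2 * P.2 = polarForm a b c P P) ∧
      ∀ P ∈ S, P ≠ 0 → ∀ V, tangentForm φ P V = polarForm a b c P V - V.2 := by
  classical
  have hcard : 3 ≤ (S.erase 0).card := by rw [Finset.card_erase_of_mem h0]; omega
  obtain ⟨T, hT, hT3⟩ := Finset.exists_subset_card_eq hcard
  obtain ⟨P, Q, R, hPQ, hPR, hQR, rfl⟩ := Finset.card_eq_three.1 hT3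
  simp only [Finset.insert_subset_iff, Finset.singleton_subset_iff, Finset.mem_erase] at hT
  obtain ⟨⟨hP0, hP⟩, ⟨hQ0, hQ⟩, ⟨hR0, hR⟩⟩ := hT
  have hw : wedge P Q ≠ 0 := by
    simpa using h.arc 0 h0 P hP Q hQ hP0.symm hQ0.symm hPQ
  obtain ⟨a, b, c, e1, e2, e3⟩ :=
    exists_polarForm hw (2 * P.2) (tangentForm φ P Q + Q.2) (2 * Q.2)
  have hcomm : ∀ u v, polarForm a b c u v = polarForm a b c v u := fun u v => by
    simp only [polarForm]; ring
  have hsymm := fun {A B} (hA : A ∈ S) (hA0 : A ≠ 0) (hB : B ∈ S) (hB0 : B ≠ 0) =>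
    h.tangentForm_symm hφ h0 h10 hy hA hA0 hB hB0
  have hself := fun {A} (hA : A ∈ S) (hA0 : A ≠ 0) => h.tangentForm_self hφ h0 hA hA0
  have hTP : ∀ V, tangentForm φ P V = polarForm a b c P V - V.2 :=
    tangentForm_eq_of_eq hw (by rw [hself hP hP0, e1]; ring) (by rw [e2]; ring)
  have hTQ : ∀ V, tangentForm φ Q V = polarForm a b c Q V - V.2 :=
    tangentForm_eq_of_eq hw (by rw [hcomm, e2, hsymm hP hP0 hQ hQ0]; ring)
      (by rw [hself hQ hQ0, e3]; ring)
  have hTX : ∀ X ∈ S, X ≠ 0 → ∀ V, tangentForm φ X V = polarForm a b c X V - V.2 := by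
    intro X hX hX0
    refine tangentForm_eq_of_eq hw ?_ ?_
    · rw [hcomm]; linear_combination hTP X - hsymm hP hP0 hX hX0
    · rw [hcomm]; linear_combination hTQ X - hsymm hQ hQ0 hX hX0
  have hconic : ∀ X ∈ S, 2 * X.2 = polarForm a b c X X := by
    intro X hX
    by_cases hX0 : X = 0
    · simp [hX0, polarForm]
    · linear_combination hTX X hX hX0 X - hself hX hX0
  refine ⟨a, b, c, ?_, hconic, hTX⟩
  rintro rfl
  -- otherwise the nonzero points lie on the line `2 * b * x + c * y = 2`
  have hline : ∀ X ∈ S, X ≠ 0 → 2 * b * X.1 + c * X.2 = 2 := fun X hX hX0 => by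
    refine mul_right_cancel₀ (hy X hX hX0) ?_
    have := hconic X hX
    simp only [polarForm] at this
    linear_combination -this
  have lP := hline P hP hP0
  have lQ := hline Q hQ hQ0
  have lR := hline R hR hR0
  obtain ⟨hb, hc⟩ := eq_zero_of_wedge_ne_zero (h.arc P hP Q hQ R hR hPQ hPR hQR)
    (p := 2 * b) (q := c)
    (by simp only [Prod.fst_sub, Prod.snd_sub]; linear_combination lQ - lP)
    (by simp only [Prod.fst_sub, Prod.snd_sub]; linear_combination lR - lP)
  rw [hb, hc] at lP
  exact h2 (by simpa using lP.symm)

end IsSharplyFocusedOn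

/-- The nonzero vectors parallel to a vector in `D`. -/
def rays (D : Finset (F × F)) : Set (F × F) := {z | z ≠ 0 ∧ ∃ d ∈ D, wedge d z = 0}

lemma ncard_rays [Fintype F] {D : Finset (F × F)} (h0 : ∀ d ∈ D, d ≠ 0)
    (hw : ∀ d ∈ D, ∀ e ∈ D, d ≠ e → wedge d e ≠ 0) :
    (rays D).ncard = D.card * (Fintype.card F - 1) := by
  classical
  have himage : rays D =
      (((D ×ˢ (Finset.univ : Finset Fˣ)).image fun p => p.2 • p.1 : Finset (F × F)) :
        Set (F × F)) := by
    ext z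
    simp only [rays, Set.mem_ofPred_eq, Finset.coe_image, Set.mem_image, Finset.mem_coe,
      Finset.mem_product, Finset.mem_univ, and_true]
    constructor
    · rintro ⟨hz, d, hd, hdz⟩
      obtain ⟨c, rfl⟩ := exists_smul_of_wedge_eq_zero (h0 d hd) hdz
      have hc : c ≠ 0 := by rintro rfl; simp at hz
      exact ⟨(d, Units.mk0 c hc), hd, rfl⟩
    · rintro ⟨⟨d, c⟩, hd, rfl⟩
      refine ⟨by simpa [Units.smul_def] using h0 _ hd, d, hd, ?_⟩
      simp only [wedge, Prod.smul_fst, Prod.smul_snd, Units.smul_def, smul_eq_mul]; ring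
  rw [himage, Set.ncard_coe_finset, Finset.card_image_of_injOn, Finset.card_product,
    Finset.card_univ, Fintype.card_units]
  rintro ⟨d, c⟩ hd ⟨e, c'⟩ he heq
  simp only [Finset.coe_product, Set.mem_prod, Finset.mem_coe, Finset.coe_univ, Set.mem_univ,
    and_true] at hd he
  dsimp only at heq
  have hde : d = e := by
    by_contra hne
    refine hw d hd e he hne (wedge_eq_zero_trans (v := c • d) ?_ ?_ ?_)
    · simpa [Units.smul_def] using h0 d hd
    · simp only [wedge, Prod.smul_fst, Prod.smul_snd, Units.smul_def, smul_eq_mul]; ring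
    · rw [heq]
      simp only [wedge, Prod.smul_fst, Prod.smul_snd, Units.smul_def, smul_eq_mul]; ring
  subst hde
  rw [Prod.mk.injEq]
  refine ⟨rfl, Units.ext (smul_left_injective F (h0 d hd) ?_)⟩
  simpa [Units.smul_def] using heq

namespace QuadraticAlgebra

variable {α β : F}

/-- The coordinates of a unit of a quadratic algebra. -/
def unitCoords (u : (QuadraticAlgebra F α β)ˣ) : F × F := (u.val.re, u.val.im)

lemma unitCoords_injective :
    Function.Injective (unitCoords : (QuadraticAlgebra F α β)ˣ → F × F) := fun u v h => by
  rw [unitCoords, unitCoords, Prod.mk.injEq] at h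
  exact Units.ext (QuadraticAlgebra.ext h.1 h.2)

lemma exists_unitCoords_eq_iff {z : F × F} :
    (∃ u : (QuadraticAlgebra F α β)ˣ, unitCoords u = z) ↔
      z.1 * z.1 + β * z.1 * z.2 - α * z.2 * z.2 ≠ 0 := by
  have : IsUnit (⟨z.1, z.2⟩ : QuadraticAlgebra F α β) ↔
      z.1 * z.1 + β * z.1 * z.2 - α * z.2 * z.2 ≠ 0 := by
    rw [isUnit_iff_norm_isUnit, isUnit_iff_ne_zero, norm_def]
  rw [← this]
  constructor
  · rintro ⟨u, rfl⟩; exact u.isUnit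
  · rintro ⟨u, hu⟩; exact ⟨u, by rw [unitCoords, hu]⟩

lemma unitCoords_ne_zero (u : (QuadraticAlgebra F α β)ˣ) : unitCoords u ≠ 0 := by
  intro h
  exact exists_unitCoords_eq_iff.1 ⟨u, h⟩ (by simp)

lemma unitCoords_mul (u v : (QuadraticAlgebra F α β)ˣ) :
    unitCoords (u * v) = ((unitCoords u).1 * (unitCoords v).1 + α * (unitCoords u).2 *
        (unitCoords v).2, (unitCoords u).1 * (unitCoords v).2 + (unitCoords u).2 *
        (unitCoords v).1 + β * (unitCoords u).2 * (unitCoords v).2) := by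
  simp [unitCoords]

/-- A quadratic algebra over a field of order `q` has `(q + 1 - j) * (q - 1)` units,
where `j ≤ 2` is the number of roots of its polynomial. -/
lemma card_units [Fintype F] :
    ∃ j ≤ 2, Nat.card (QuadraticAlgebra F α β)ˣ =
      (Fintype.card F + 1 - j) * (Fintype.card F - 1) := by
  classical
  let R : Finset F := Finset.univ.filter fun r => r * r + β * r - α = 0
  have hR : R.card ≤ 2 := by
    by_cases hne : R.Nonempty
    · obtain ⟨s, hs⟩ := hne
      refine (Finset.card_le_card (t := {s, -β - s}) fun r hr => ?_).trans Finset.card_le_two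
      simp only [R, Finset.mem_filter, Finset.mem_univ, true_and] at hr hs
      have : (r - s) * (r + s + β) = 0 := by linear_combination hr - hs
      rcases mul_eq_zero.1 this with h | h
      · simp [sub_eq_zero.1 h]
      · simp only [Finset.mem_insert, Finset.mem_singleton]
        right; linear_combination h
    · simp [Finset.not_nonempty_iff_eq_empty.1 hne]
  let E : Finset (F × F) := insert (1, 0) (Rᶜ.image fun r => (r, 1))
  have hE : ∀ z, z ∈ E ↔ z = (1, 0) ∨ ∃ r, r * r + β * r - α ≠ 0 ∧ (r, 1) = z := by
    intro z; simp [E, R]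
  have hcard : E.card = Fintype.card F + 1 - R.card := by
    rw [Finset.card_insert_of_notMem (by simp), Finset.card_image_of_injective _
      (fun x y h => by simpa using h), Finset.card_compl]
    have := Finset.card_le_univ R
    omega
  have hrange : Set.range (unitCoords : (QuadraticAlgebra F α β)ˣ → F × F) = rays E := by
    ext z
    rw [Set.mem_range, exists_unitCoords_eq_iff]
    obtain ⟨x, y⟩ := z
    simp only [rays, Set.mem_ofPred_eq, hE]
    constructor
    · intro hz
      refine ⟨by rintro h; simp_all, ?_⟩
      by_cases hy : y = 0
      · exact ⟨(1, 0), Or.inl rfl, by simp [wedge, hy]⟩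
      · refine ⟨(x / y, 1), Or.inr ⟨x / y, fun h => hz ?_, rfl⟩, ?_⟩
        · field_simp at h
          linear_combination h
        · simp only [wedge]; field_simp; ring
    · rintro ⟨hz, d, rfl | ⟨r, hr, rfl⟩, hd⟩
      · have hy : y = 0 := by simpa [wedge] using hd
        subst hy
        have hx : x ≠ 0 := by rintro rfl; exact hz rfl
        simpa using hx
      · have hx : x = r * y := by simp only [wedge] at hd; linear_combination -hd
        subst hx
        have hy : y ≠ 0 := by rintro rfl; simp at hz
        intro h
        apply hr
        refine (mul_eq_zero.1 (?_ : (y * y) * (r * r + β * r - α) = 0)).resolve_left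
          (mul_ne_zero hy hy)
        linear_combination h
  refine ⟨R.card, hR, ?_⟩
  rw [← hcard, ← ncard_rays (D := E), ← hrange, ← Set.image_univ,
    Set.ncard_image_of_injective _ unitCoords_injective, Set.ncard_univ]
  · intro d hd
    rcases (hE d).1 hd with rfl | ⟨r, -, rfl⟩ <;> simp
  · intro d hd e he hne
    rcases (hE d).1 hd with rfl | ⟨r, -, rfl⟩ <;> rcases (hE e).1 he with rfl | ⟨s, -, rfl⟩
    · exact absurd rfl hne
    · simp [wedge]
    · simp [wedge]
    · simp only [wedge, mul_one, one_mul]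
      exact sub_ne_zero.2 fun h => hne (by rw [h])

end QuadraticAlgebra

lemma ncard_dvd_card_of_mul_mem {G : Type*} [Group G] [Finite G] {T : Set G} (h1 : 1 ∈ T)
    (hmul : ∀ u ∈ T, ∀ v ∈ T, u * v ∈ T) : T.ncard ∣ Nat.card G := by
  let M : Submonoid G := ⟨⟨T, fun hu hv => hmul _ hu _ hv⟩, h1⟩
  let H : Subgroup G :=
    { M with
      inv_mem' := fun {u} (hu : u ∈ M) => by
        have : u⁻¹ = u ^ (orderOf u - 1) := by
          rw [inv_eq_iff_mul_eq_one, ← pow_succ', Nat.sub_add_cancel (orderOf_pos u),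
            pow_orderOf_eq_one]
        rw [this]
        exact pow_mem hu _ }
  exact H.card_subgroup_dvd_card

namespace IsSharplyFocusedOn

variable {S D : Finset (F × F)}

open QuadraticAlgebra in
/-- The directions of a sharply focused arc on a conic
`2 * y = a * x ^ 2 + 2 * b * x * y + c * y ^ 2` form a group under the multiplication
of a quadratic algebra. -/
theorem card_dvd [Fintype F] (h : IsSharplyFocusedOn S D) (h2 : (2 : F) ≠ 0)
    (h0 : 0 ∈ S) (h10 : ((1, 0) : F × F) ∈ D) (hy : ∀ P ∈ S, P ≠ 0 → P.2 ≠ 0)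
    {φ : F × F → F × F → F × F} (hφ : IsDirMap S D φ) {a b c : F} (ha : a ≠ 0)
    (hconic : ∀ P ∈ S, 2 * P.2 = polarForm a b c P P)
    (htan : ∀ P ∈ S, P ≠ 0 → ∀ V, tangentForm φ P V = polarForm a b c P V - V.2) :
    S.card ∣ Fintype.card F + 1 ∨ S.card ∣ Fintype.card F - 1 ∨ S.card ∣ Fintype.card F := by
  classical
  set α : F := -(c / a) with hα
  set β : F := 2 * b / a with hβ
  have hαa : a * α = -c := by rw [hα]; field_simp
  have hβa : a * β = 2 * b := by rw [hβ]; field_simp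
  have hrep : ∀ d ∈ D, ∃ z : F × F, (z = (1, 0) ∨ z ∈ S ∧ z ≠ 0) ∧ wedge d z = 0 := by
    intro d hd
    obtain ⟨P, hP, rfl⟩ := (hφ 0 h0).1.surjOn hd
    by_cases hP0 : P = 0
    · exact ⟨(1, 0), Or.inl rfl, by rw [hP0, dirMap_zero hφ h0 h10 hy]; simp [wedge]⟩
    · exact ⟨P, Or.inr ⟨hP, hP0⟩, by simpa using (hφ 0 h0).2 P hP hP0⟩
  have hdir : ∀ z : F × F, (z = (1, 0) ∨ z ∈ S ∧ z ≠ 0) → ∃ d ∈ D, wedge d z = 0 := by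
    rintro z (rfl | ⟨hz, hz0⟩)
    · exact ⟨_, h10, by simp [wedge]⟩
    · exact ⟨φ 0 z, (hφ 0 h0).1.mapsTo hz, by simpa using (hφ 0 h0).2 z hz hz0⟩
  have hne : ∀ z : F × F, (z = (1, 0) ∨ z ∈ S ∧ z ≠ 0) →
      z ≠ 0 ∧ z.1 * z.1 + β * z.1 * z.2 - α * z.2 * z.2 ≠ 0 := by
    rintro z (rfl | ⟨hz, hz0⟩)
    · simp
    · refine ⟨hz0, fun hN => mul_ne_zero h2 (hy z hz hz0) ?_⟩
      rw [hconic z hz, polarForm]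
      linear_combination a * hN - z.1 * z.2 * hβa + z.2 * z.2 * hαa
  have hprod : ∀ z w : F × F, (z = (1, 0) ∨ z ∈ S ∧ z ≠ 0) → (w = (1, 0) ∨ w ∈ S ∧ w ≠ 0) →
      ∃ d ∈ D, wedge d (z.1 * w.1 + α * z.2 * w.2, z.1 * w.2 + z.2 * w.1 + β * z.2 * w.2) = 0 := by
    intro z w hz hw
    rcases hz with rfl | ⟨hz, hz0⟩
    · simpa using hdir w hw
    rcases hw with rfl | ⟨hw, hw0⟩
    · simpa using hdir z (Or.inr ⟨hz, hz0⟩)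
    by_cases hzw : z = w
    · subst hzw
      refine ⟨φ z z, (hφ z hz).1.mapsTo hz, ?_⟩
      have ht := htan z hz hz0
        (z.1 * z.1 + α * z.2 * z.2, z.1 * z.2 + z.2 * z.1 + β * z.2 * z.2)
      rw [tangentForm] at ht
      refine (mul_eq_zero.1 (ht.trans ?_)).resolve_left
        (div_ne_zero (hy z hz hz0) (h.wedge_tangent_self_ne_zero hφ h0 hz hz0))
      have hc := hconic z hz
      simp only [polarForm] at hc ⊢
      refine (mul_eq_zero.1 (?_ : a * _ = 0)).resolve_left ha
      linear_combination -(a * z.1 + b * z.2) * hc +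
        (a * z.1 * z.2 * z.2 + b * z.2 * z.2 * z.2) * hαa +
        (b * z.1 * z.2 * z.2 + c * z.2 * z.2 * z.2 - z.2 * z.2) * hβa
    · refine ⟨φ z w, (hφ z hz).1.mapsTo hw, wedge_eq_zero_trans (sub_ne_zero.2 (Ne.symm hzw))
        ((hφ z hz).2 w hw (Ne.symm hzw)) ?_⟩
      have hcz := hconic z hz
      have hcw := hconic w hw
      simp only [polarForm] at hcz hcw
      simp only [wedge, Prod.fst_sub, Prod.snd_sub]
      refine (mul_eq_zero.1 (?_ : a * _ = 0)).resolve_left ha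
      linear_combination w.2 * hcz - z.2 * hcw - (w.2 - z.2) * z.2 * w.2 * hαa +
        (w.1 - z.1) * z.2 * w.2 * hβa
  let T : Set (QuadraticAlgebra F α β)ˣ := {u | ∃ d ∈ D, wedge d (unitCoords u) = 0}
  have hscale : ∀ u ∈ T, ∃ z : F × F, (z = (1, 0) ∨ z ∈ S ∧ z ≠ 0) ∧
      ∃ s : F, unitCoords u = s • z := by
    rintro u ⟨d, hd, hdu⟩
    obtain ⟨z, hz, hdz⟩ := hrep d hd
    exact ⟨z, hz, exists_smul_of_wedge_eq_zero (hne z hz).1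
      (wedge_eq_zero_trans (h.ne_zero d hd) (wedge_comm_eq_zero hdz) hdu)⟩
  have hT1 : (1 : (QuadraticAlgebra F α β)ˣ) ∈ T := ⟨_, h10, by simp [unitCoords, wedge]⟩
  have hTmul : ∀ u ∈ T, ∀ v ∈ T, u * v ∈ T := by
    intro u hu v hv
    obtain ⟨z, hz, s, hs⟩ := hscale u hu
    obtain ⟨w, hw, t, ht⟩ := hscale v hv
    obtain ⟨d, hd, hdzw⟩ := hprod z w hz hw
    refine ⟨d, hd, ?_⟩
    rw [unitCoords_mul, hs, ht]
    simp only [wedge, Prod.smul_fst, Prod.smul_snd, smul_eq_mul] at hdzw ⊢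
    linear_combination s * t * hdzw
  have hTrays : unitCoords '' T = rays D := by
    ext x
    constructor
    · rintro ⟨u, hu, rfl⟩
      exact ⟨unitCoords_ne_zero u, hu⟩
    · rintro ⟨hx, d, hd, hdx⟩
      obtain ⟨z, hz, hdz⟩ := hrep d hd
      obtain ⟨s, rfl⟩ := exists_smul_of_wedge_eq_zero (hne z hz).1
        (wedge_eq_zero_trans (h.ne_zero d hd) (wedge_comm_eq_zero hdz) hdx)
      have hs : s ≠ 0 := by rintro rfl; simp at hx
      obtain ⟨u, hu⟩ := (exists_unitCoords_eq_iff (α := α) (β := β) (z := s • z)).2 (by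
        simp only [Prod.smul_fst, Prod.smul_snd, smul_eq_mul]
        intro hN
        refine mul_ne_zero (mul_ne_zero hs hs) (hne z hz).2 ?_
        linear_combination hN)
      exact ⟨u, ⟨d, hd, by rw [hu]; exact hdx⟩, hu⟩
  have hfin : Finite (QuadraticAlgebra F α β)ˣ := Finite.of_injective _ unitCoords_injective
  have hdvd := ncard_dvd_card_of_mul_mem hT1 hTmul
  obtain ⟨j, hj, hunits⟩ := card_units (F := F) (α := α) (β := β)
  rw [← Set.ncard_image_of_injective T unitCoords_injective, hTrays,
    ncard_rays h.ne_zero h.wedge_ne_zero, hunits] at hdvd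
  have hq := Fintype.one_lt_card (α := F)
  have := Nat.dvd_of_mul_dvd_mul_right (by omega) hdvd
  rw [h.card_eq]
  interval_cases j
  · exact Or.inl this
  · exact Or.inr (Or.inr this)
  · exact Or.inr (Or.inl this)

end IsSharplyFocusedOn

open MvPolynomial in
/-- Substituting the coordinates of an invertible matrix is an automorphism
of the polynomial ring. -/
noncomputable def matrixSubst {n : Type*} [Fintype n] [DecidableEq n] (M N : Matrix n n F)
    (hMN : M * N = 1) (hNM : N * M = 1) : MvPolynomial n F ≃ₐ[F] MvPolynomial n F :=
  AlgEquiv.ofAlgHom (aeval M.toMvPolynomial) (aeval N.toMvPolynomial)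
    (by
      ext1 i
      have := Matrix.toMvPolynomial_mul N M i
      rw [hNM, Matrix.toMvPolynomial_one] at this
      simpa [aeval_eq_bind₁] using this.symm)
    (by
      ext1 i
      have := Matrix.toMvPolynomial_mul M N i
      rw [hMN, Matrix.toMvPolynomial_one] at this
      simpa [aeval_eq_bind₁] using this.symm)

open MvPolynomial in
lemma isConic_of_linearEquiv (e : (Fin 3 → F) ≃ₗ[F] (Fin 3 → F)) {Q : MvPolynomial (Fin 3) F}
    (hhom : Q.IsHomogeneous 2) (hirr : Irreducible Q) :
    IsConic {P : PG2 F | eval (e P.rep) Q = 0} := by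
  let M := LinearMap.toMatrix' e.toLinearMap
  let N := LinearMap.toMatrix' e.symm.toLinearMap
  have hMN : M * N = 1 := by
    rw [← LinearMap.toMatrix'_comp]; simp
  have hNM : N * M = 1 := by
    rw [← LinearMap.toMatrix'_comp]; simp
  refine ⟨matrixSubst M N hMN hNM Q, ?_, ?_, ?_⟩
  · have := hhom.aeval M.toMvPolynomial (n := 1) fun i => Matrix.toMvPolynomial_isHomogeneous M i
    rwa [one_mul] at this
  · exact (MulEquiv.irreducible_iff (matrixSubst M N hMN hNM)).2 hirr
  · ext P
    have : eval P.rep (matrixSubst M N hMN hNM Q) = eval (e P.rep) Q := by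
      have hcomp (Q : MvPolynomial (Fin 3) F) : eval P.rep (aeval M.toMvPolynomial Q) =
          eval (fun i => eval P.rep (M.toMvPolynomial i)) Q := by
        induction Q using MvPolynomial.induction_on <;> simp_all
      have hM : (fun i => eval P.rep (M.toMvPolynomial i)) = e P.rep := by
        ext i
        rw [Matrix.toMvPolynomial_eval_eq_apply, LinearMap.toMatrix'_mulVec]
        rfl
      rw [← hM, ← hcomp]; rfl
    simp [this]

open MvPolynomial in
/-- The quadratic form of the affine conic `2 * y = a * x ^ 2 + 2 * b * x * y + c * y ^ 2`. -/
noncomputable def conicForm (a b c : F) : MvPolynomial (Fin 3) F :=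
  C (-2) * X 1 * X 2 + (C a * X 0 ^ 2 + C (2 * b) * (X 0 * X 1) + C c * X 1 ^ 2)

open MvPolynomial in
lemma conicForm_isHomogeneous (a b c : F) : (conicForm a b c).IsHomogeneous 2 := by
  have hX (i : Fin 3) := isHomogeneous_X F i
  have hC (r : F) := isHomogeneous_C (Fin 3) r
  exact (((hC _).mul (hX 1)).mul (hX 2)).add
    ((((hC _).mul ((hX 0).pow 2)).add ((hC _).mul ((hX 0).mul (hX 1)))).add
      ((hC _).mul ((hX 1).pow 2)))

open MvPolynomial in
lemma conicForm_irreducible {a b c : F} (h2 : (2 : F) ≠ 0) (ha : a ≠ 0) :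
    Irreducible (conicForm a b c) := by
  have hvars (p : MvPolynomial (Fin 2) F) : (2 : Fin 3) ∉ (rename ![0, 1] p).vars := by
    intro h
    obtain ⟨i, -, hi⟩ := mem_vars_rename _ _ h
    fin_cases i <;> simp at hi
  have h₁ : (2 : Fin 3) ∉ (C (-2) * X 1 : MvPolynomial (Fin 3) F).vars := by
    have := hvars (C (-2) * X 1)
    rwa [map_mul, rename_C, rename_X] at this
  have h₂ : (2 : Fin 3) ∉ (C a * X 0 ^ 2 + C (2 * b) * (X 0 * X 1) + C c * X 1 ^ 2 :
      MvPolynomial (Fin 3) F).vars := by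
    have := hvars (C a * X 0 ^ 2 + C (2 * b) * (X 0 * X 1) + C c * X 1 ^ 2)
    simp only [map_add, map_mul (rename _), map_pow, rename_C, rename_X] at this
    exact this
  have h₀ : (C (-2) * X 1 : MvPolynomial (Fin 3) F) ≠ 0 :=
    mul_ne_zero (by simpa using h2) (X_ne_zero 1)
  have hrel : IsRelPrime (C (-2) * X 1 : MvPolynomial (Fin 3) F)
      (C a * X 0 ^ 2 + C (2 * b) * (X 0 * X 1) + C c * X 1 ^ 2) := by
    have hunit : IsUnit (C (-2) : MvPolynomial (Fin 3) F) :=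
      (isUnit_iff_ne_zero.2 (neg_ne_zero.2 h2)).map C
    rw [isRelPrime_mul_unit_left_left hunit, X_prime.irreducible.isRelPrime_iff_not_dvd]
    rintro ⟨p, hp⟩
    have := congrArg (eval ![1, 0, 0]) hp
    simp [ha] at this
  rw [conicForm]
  exact irreducible_mul_X_add _ _ 2 h₀ h₁ h₂ hrel

section

variable {K : Set (PG2 F)}

lemma PG2.eq_of_rep_eq_smul {P Q : PG2 F} {c : F} (h : P.rep = c • Q.rep) : P = Q := by
  rw [← P.mk_rep, ← Q.mk_rep, Projectivization.mk_eq_mk_iff']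
  exact ⟨c, h.symm⟩

lemma IsArc.not_forall_eq_zero [Finite F] (harc : IsArc K) {P Q R : PG2 F} (hP : P ∈ K)
    (hQ : Q ∈ K) (hR : R ∈ K) (hPQ : P ≠ Q) (hPR : P ≠ R) (hQR : Q ≠ R)
    {g : (Fin 3 → F) →ₗ[F] F} (hg : g ≠ 0) :
    ¬ (g P.rep = 0 ∧ g Q.rep = 0 ∧ g R.rep = 0) := by
  rintro ⟨h1, h2, h3⟩
  have hle := harc _ ⟨g, hg, rfl⟩
  have hsub : {P, Q, R} ⊆ K ∩ {X : PG2 F | g X.rep = 0} := by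
    rintro X (rfl | rfl | rfl)
    exacts [⟨hP, h1⟩, ⟨hQ, h2⟩, ⟨hR, h3⟩]
  have h3 : ({P, Q, R} : Set (PG2 F)).ncard = 3 :=
    Set.ncard_eq_three.2 ⟨P, Q, R, hPQ, hPR, hQR, rfl⟩
  have := Set.ncard_le_ncard hsub (Set.toFinite _)
  omega

/-- The representative of a point on which the linear form `f` takes the value `1`. -/
noncomputable def affineRep (f : (Fin 3 → F) →ₗ[F] F) (P : PG2 F) : Fin 3 → F :=
  (f P.rep)⁻¹ • P.rep

variable {f : (Fin 3 → F) →ₗ[F] F}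

lemma apply_affineRep {P : PG2 F} (hP : f P.rep ≠ 0) : f (affineRep f P) = 1 := by
  simp [affineRep, hP]

lemma rep_eq_smul_affineRep {P : PG2 F} (hP : f P.rep ≠ 0) :
    P.rep = f P.rep • affineRep f P := by
  simp [affineRep, hP]

lemma affineRep_injective {P Q : PG2 F} (hP : f P.rep ≠ 0)
    (h : affineRep f P = affineRep f Q) : P = Q := by
  refine PG2.eq_of_rep_eq_smul (c := f P.rep * (f Q.rep)⁻¹) ?_
  calc P.rep = f P.rep • affineRep f P := rep_eq_smul_affineRep hP
    _ = _ := by rw [h, affineRep, smul_smul]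

lemma exists_focus [Finite F] {P Q : PG2 F} (hP : P ∈ K) (hQ : Q ∈ K)
    (hPQ : P ≠ Q) (hfP : f P.rep ≠ 0) (hfQ : f Q.rep ≠ 0) :
    ∃ X ∈ FocusSet K {X : PG2 F | f X.rep = 0},
      ∃ c : F, X.rep = c • (affineRep f Q - affineRep f P) := by
  classical
  have hne : affineRep f Q - affineRep f P ≠ 0 :=
    sub_ne_zero.2 fun h => hPQ (affineRep_injective hfQ h).symm
  obtain ⟨c, hc⟩ := Projectivization.exists_smul_eq_mk_rep F _ hne
  have hc' : (Projectivization.mk F _ hne).rep = (c : F) • (affineRep f Q - affineRep f P) :=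
    hc.symm
  have hlt : Submodule.span F {P.rep, Q.rep} < ⊤ := by
    refine lt_top_iff_ne_top.2 fun h => ?_
    have h1 := finrank_span_finset_le_card (R := F) ({P.rep, Q.rep} : Finset (Fin 3 → F))
    have h2 := Finset.card_le_two (a := P.rep) (b := Q.rep)
    rw [Finset.coe_pair, Set.finrank, h, finrank_top] at h1
    simp at h1
    omega
  obtain ⟨g, hg, hle⟩ := Submodule.exists_le_ker_of_lt_top _ hlt
  have hgP : g P.rep = 0 := hle (Submodule.subset_span (by simp))
  have hgQ : g Q.rep = 0 := hle (Submodule.subset_span (by simp))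
  refine ⟨Projectivization.mk F _ hne, ⟨?_, {X : PG2 F | g X.rep = 0}, ⟨⟨g, hg, rfl⟩, ?_⟩, ?_⟩,
    c, hc'⟩
  · change f _ = 0
    rw [hc', map_smul, map_sub, apply_affineRep hfP, apply_affineRep hfQ, sub_self, smul_zero]
  · rw [← Set.ncard_pair hPQ]
    refine Set.ncard_le_ncard ?_ (Set.toFinite _)
    rintro X (rfl | rfl)
    exacts [⟨hP, hgP⟩, ⟨hQ, hgQ⟩]
  · change g _ = 0
    rw [hc', map_smul, map_sub, affineRep, affineRep, map_smul, map_smul, hgP, hgQ]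
    simp

/-- Some focus is not on any chord through a given point of a sharply focused arc. -/
lemma exists_missed_focus [Finite F] {L : Set (PG2 F)} (hL : K.ncard ≤ L.ncard)
    {O : PG2 F} (hO : O ∈ K) (hf : ∀ P ∈ K, f P.rep ≠ 0) :
    ∃ T ∈ L, ∀ X ∈ K, X ≠ O → ∀ c : F, affineRep f X - affineRep f O ≠ c • T.rep := by
  by_contra! hcon
  choose! g hgK hgO c hc using hcon
  have hle : L.ncard ≤ (K \ {O}).ncard := by
    refine Set.ncard_le_ncard_of_injOn g (fun T hT => ⟨hgK T hT, hgO T hT⟩) ?_ (Set.toFinite _)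
    intro T hT U hU hTU
    have h1 := hc T hT
    have h2 := hc U hU
    rw [hTU] at h1
    have hcT : c T ≠ 0 := by
      intro h0
      rw [h0, zero_smul, sub_eq_zero] at h1
      exact hgO U hU (affineRep_injective (hf _ (hgK U hU)) h1)
    refine PG2.eq_of_rep_eq_smul (c := (c T)⁻¹ * c U) ?_
    rw [mul_smul, ← h2, h1, inv_smul_smul₀ hcT]
  have := Set.ncard_sdiff_singleton_add_one hO (Set.toFinite K)
  omega

/-- The first two coordinates of a vector with respect to the linear coordinates `e`. -/
def planeCoords (e : (Fin 3 → F) ≃ₗ[F] (Fin 3 → F)) : (Fin 3 → F) →ₗ[F] F × F :=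
  ((LinearMap.proj 0).comp e.toLinearMap).prod ((LinearMap.proj 1).comp e.toLinearMap)

variable {e : (Fin 3 → F) ≃ₗ[F] (Fin 3 → F)}

lemma eq_of_planeCoords_eq (he : ∀ v, e v 2 = f v) {u v : Fin 3 → F} (hf : f u = f v)
    (h : planeCoords e u = planeCoords e v) : u = v := by
  apply e.injective
  have h' := Prod.ext_iff.1 h
  funext i
  fin_cases i
  · exact h'.1
  · exact h'.2
  · exact (he u).trans (hf.trans (he v).symm)

open Classical in
/-- In affine coordinates with `l` at infinity, a sharply focused arc satisfies
`IsSharplyFocusedOn`. -/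
lemma isSharplyFocusedOn_planeCoords [Finite F] (harc : IsArc K)
    (hcard : (FocusSet K {X : PG2 F | f X.rep = 0}).ncard = K.ncard)
    (hf : ∀ P ∈ K, f P.rep ≠ 0) (he : ∀ v, e v 2 = f v) :
    IsSharplyFocusedOn
      ((Set.toFinite K).toFinset.image fun P => planeCoords e (affineRep f P))
      ((Set.toFinite (FocusSet K {X : PG2 F | f X.rep = 0})).toFinset.image
        fun X => planeCoords e X.rep) := by
  set L := FocusSet K {X : PG2 F | f X.rep = 0} with hL
  have hLf : ∀ X ∈ L, f X.rep = 0 := fun X hX => hX.1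
  have hpar : ∀ X ∈ L, ∀ Y ∈ L, ∀ c : F,
      planeCoords e X.rep = c • planeCoords e Y.rep → X = Y := by
    intro X hX Y hY c h
    refine PG2.eq_of_rep_eq_smul (eq_of_planeCoords_eq he ?_ (h.trans (map_smul _ _ _).symm))
    rw [map_smul, hLf X hX, hLf Y hY, smul_zero]
  have hL0 : ∀ X ∈ L, planeCoords e X.rep ≠ 0 := by
    intro X hX h
    refine X.rep_nonzero (eq_of_planeCoords_eq he ?_ (h.trans (map_zero _).symm))
    rw [map_zero, hLf X hX]
  have hinj : ∀ P ∈ K, ∀ Q ∈ K,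
      planeCoords e (affineRep f P) = planeCoords e (affineRep f Q) → P = Q := by
    intro P hP Q hQ h
    refine affineRep_injective (hf P hP) (eq_of_planeCoords_eq he ?_ h)
    rw [apply_affineRep (hf P hP), apply_affineRep (hf Q hQ)]
  constructor
  · rw [Finset.card_image_of_injOn, Finset.card_image_of_injOn, ← Set.ncard_eq_toFinset_card,
      ← Set.ncard_eq_toFinset_card, hcard]
    · intro X hX Y hY h
      exact hpar X (by simpa using hX) Y (by simpa using hY) 1 (by rw [one_smul]; exact h)
    · intro P hP Q hQ h
      exact hinj P (by simpa using hP) Q (by simpa using hQ) h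
  · simp only [Finset.mem_image, Set.Finite.mem_toFinset]
    rintro _ ⟨P, hP, rfl⟩ _ ⟨Q, hQ, rfl⟩ _ ⟨R, hR, rfl⟩ hPQ hPR hQR hw
    let coords := fun X => planeCoords e (affineRep f X)
    set A := planeCoords e (affineRep f P)
    set B := planeCoords e (affineRep f Q)
    set C := planeCoords e (affineRep f R)
    let g₀ : (Fin 3 → F) →ₗ[F] F := (B.1 - A.1) • (LinearMap.proj 1 - A.2 • LinearMap.proj 2) -
      (B.2 - A.2) • (LinearMap.proj 0 - A.1 • LinearMap.proj 2)
    let g : (Fin 3 → F) →ₗ[F] F := g₀.comp e.toLinearMap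
    have hg : ∀ v, g v = (B.1 - A.1) * ((planeCoords e v).2 - A.2 * f v) -
        (B.2 - A.2) * ((planeCoords e v).1 - A.1 * f v) := by
      intro v
      rw [← he v]
      simp [g, g₀, planeCoords]
    have hzero : ∀ {X : PG2 F}, X ∈ K → g (affineRep f X) = 0 → g X.rep = 0 := by
      intro X hX h
      rw [rep_eq_smul_affineRep (hf X hX), map_smul, h, smul_zero]
    refine harc.not_forall_eq_zero hP hQ hR (fun h => hPQ (congrArg coords h))
      (fun h => hPR (congrArg coords h)) (fun h => hQR (congrArg coords h)) (g := g) ?_ ⟨hzero hP ?_, hzero hQ ?_, hzero hR ?_⟩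
    · intro h0
      have h1 : g₀ = 0 := by
        ext1 i
        ext
        have := LinearMap.congr_fun h0 (e.symm (Pi.single i 1))
        simpa [g] using this
      have h2 := LinearMap.congr_fun h1 (Pi.single 0 1)
      have h3 := LinearMap.congr_fun h1 (Pi.single 1 1)
      simp [g₀] at h2 h3
      exact hPQ (Prod.ext (by linear_combination -h3) (by linear_combination h2))
    · rw [hg, apply_affineRep (hf P hP)]; ring
    · rw [hg, apply_affineRep (hf Q hQ)]; ring
    · rw [hg, apply_affineRep (hf R hR)]
      simp only [wedge, Prod.fst_sub, Prod.snd_sub] at hw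
      linear_combination hw
  · simp only [Finset.mem_image, Set.Finite.mem_toFinset]
    rintro _ ⟨X, hX, rfl⟩
    exact hL0 X hX
  · simp only [Finset.mem_image, Set.Finite.mem_toFinset]
    rintro _ ⟨X, hX, rfl⟩ _ ⟨Y, hY, rfl⟩ hne hw
    obtain ⟨c, hc⟩ := exists_smul_of_wedge_eq_zero (hL0 X hX) hw
    exact hne (by rw [hpar Y hY X hX c hc])
  · simp only [Finset.mem_image, Set.Finite.mem_toFinset]
    rintro _ ⟨P, hP, rfl⟩ _ ⟨Q, hQ, rfl⟩ hne
    obtain ⟨X, hX, c, hc⟩ := exists_focus hP hQ (fun h => hne (by rw [h])) (hf P hP) (hf Q hQ)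
    refine ⟨_, ⟨X, hX, rfl⟩, ?_⟩
    rw [hc, map_smul, map_sub]
    simp only [wedge, Prod.smul_fst, Prod.smul_snd, smul_eq_mul]
    ring

lemma exists_linearEquiv {t u o : Fin 3 → F} (ht : t ≠ 0) (hft : f t = 0) (hfu : f u = 0)
    (hfo : f o = 1) (hut : ∀ c : F, u ≠ c • t) :
    ∃ e : (Fin 3 → F) ≃ₗ[F] (Fin 3 → F), (∀ v, e v 2 = f v) ∧
      planeCoords e o = 0 ∧ planeCoords e t = (1, 0) := by
  have hli : LinearIndependent F ![t, u, o] := by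
    rw [Fintype.linearIndependent_iff]
    intro c hc
    simp only [Fin.sum_univ_three, Matrix.cons_val_zero, Matrix.cons_val_one,
      Matrix.cons_val] at hc
    have h2 : c 2 = 0 := by
      have := congrArg f hc
      simpa [hft, hfu, hfo] using this
    rw [h2, zero_smul, add_zero] at hc
    have h1 : c 1 = 0 := by
      by_contra h1
      refine hut (-((c 1)⁻¹ * c 0)) ?_
      rw [neg_smul, mul_smul, eq_neg_of_add_eq_zero_left hc, smul_neg, inv_smul_smul₀ h1, neg_neg]
    rw [h1, zero_smul, add_zero] at hc
    have h0 : c 0 = 0 := (smul_eq_zero.1 hc).resolve_right ht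
    intro i
    fin_cases i <;> assumption
  let b := basisOfLinearIndependentOfCardEqFinrank hli (by simp)
  have hb : ∀ i, b i = ![t, u, o] i := fun i => by
    simp [b]
  have hcoord : ∀ i, b.equivFun (![t, u, o] i) = Pi.single i 1 := fun i => by
    rw [← hb]
    ext j
    rw [b.equivFun_self, Pi.single_apply]
    simp [eq_comm]
  have ht' := hcoord 0
  have ho' := hcoord 2
  simp only [Matrix.cons_val_zero, Matrix.cons_val] at ht' ho'
  refine ⟨b.equivFun, fun v => ?_, ?_, ?_⟩
  · have : (LinearMap.proj 2).comp b.equivFun.toLinearMap = f := b.ext fun i => by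
      rw [LinearMap.comp_apply, LinearEquiv.coe_coe, hb, hcoord]
      fin_cases i <;> simp [hft, hfu, hfo]
    exact LinearMap.congr_fun this v
  · simp [planeCoords, ho']
  · simp [planeCoords, ht']

end

/-- Wettl: for `q` an odd prime power and `K` a `k`-arc,
`k ≥ 4`, sharply focused on a line `l`, `K` is contained in a conic and `k`
divides `q + 1`, `q - 1` or `q`. -/
theorem sharplyFocused_odd_in_conic_and_dvd {F : Type*} [Field F] [Fintype F]
    (hq : Odd (Fintype.card F)) (k : ℕ) (hk : 4 ≤ k) (K l : Set (PG2 F))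
    (harc : IsArc K) (hcard : K.ncard = k) (hsf : SharplyFocused K l) :
    (∃ C : Set (PG2 F), IsConic C ∧ K ⊆ C) ∧
      (k ∣ Fintype.card F + 1 ∨ k ∣ Fintype.card F - 1 ∨ k ∣ Fintype.card F) := by
  classical
  have h2 : (2 : F) ≠ 0 := by
    intro h
    have : CharP F 2 := CharTwo.of_one_ne_zero_of_two_eq_zero one_ne_zero h
    exact Nat.not_even_iff_odd.2 hq (Nat.even_iff.2 <| FiniteField.even_card_of_char_two (ringChar.eq F 2))
  obtain ⟨⟨f, hf0, rfl⟩, hdisj, hfocus⟩ := hsf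
  have hf : ∀ P ∈ K, f P.rep ≠ 0 := fun P hP h0 => (hdisj ▸ ⟨hP, h0⟩ : P ∈ (∅ : Set (PG2 F)))
  obtain ⟨O, P₁, hO, hP₁, hOP⟩ := (Set.one_lt_ncard_iff (Set.toFinite K)).1 (by omega)
  obtain ⟨T, hT, hmiss⟩ := exists_missed_focus hfocus.ge hO hf
  obtain ⟨e, he, heO, heT⟩ := exists_linearEquiv (f := f) T.rep_nonzero hT.1
    (by rw [map_sub, apply_affineRep (hf _ hP₁), apply_affineRep (hf _ hO), sub_self])
    (apply_affineRep (hf O hO)) (hmiss P₁ hP₁ hOP.symm)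
  have hSD := isSharplyFocusedOn_planeCoords harc hfocus hf he
  set S := (Set.toFinite K).toFinset.image fun P => planeCoords e (affineRep f P) with hS
  set D := (Set.toFinite (FocusSet K {X : PG2 F | f X.rep = 0})).toFinset.image
    fun X => planeCoords e X.rep with hD
  have hScard : S.card = k := by
    rw [hS, Finset.card_image_of_injOn, ← Set.ncard_eq_toFinset_card, hcard]
    intro P hP Q hQ h
    rw [Finset.mem_coe, Set.Finite.mem_toFinset] at hP hQ
    refine affineRep_injective (hf P hP) (eq_of_planeCoords_eq he ?_ h)
    rw [apply_affineRep (hf P hP), apply_affineRep (hf Q hQ)]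
  have hmem : ∀ P ∈ K, planeCoords e (affineRep f P) ∈ S := fun P hP =>
    Finset.mem_image.2 ⟨P, by simpa using hP, rfl⟩
  have h0 : (0 : F × F) ∈ S := heO ▸ hmem O hO
  have h10 : ((1, 0) : F × F) ∈ D := Finset.mem_image.2 ⟨T, by simpa using hT, heT⟩
  have hy : ∀ A ∈ S, A ≠ 0 → A.2 ≠ 0 := by
    intro A hA hA0 hA2
    obtain ⟨P, hP, rfl⟩ := Finset.mem_image.1 hA
    rw [Set.Finite.mem_toFinset] at hP
    refine hmiss P hP (fun h => hA0 (by rw [h, heO]))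
      (planeCoords e (affineRep f P)).1 (eq_of_planeCoords_eq he ?_ ?_)
    · rw [map_sub, apply_affineRep (hf P hP), apply_affineRep (hf O hO), map_smul,
        show f T.rep = 0 from hT.1, sub_self, smul_zero]
    · rw [map_sub, heO, map_smul, heT, sub_zero]
      exact Prod.ext (by simp) (by simpa using hA2)
  obtain ⟨φ, hφ⟩ := hSD.exists_isDirMap
  obtain ⟨a, b, c, ha, hconic, htan⟩ :=
    hSD.exists_conic hφ h2 h0 h10 hy (by omega)
  refine ⟨⟨_, isConic_of_linearEquiv e (conicForm_isHomogeneous a b c)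
    (conicForm_irreducible h2 ha), fun P hP => ?_⟩, ?_⟩
  · have hP2 : 2 * e (affineRep f P) 1 = a * e (affineRep f P) 0 * e (affineRep f P) 0 +
        b * (e (affineRep f P) 0 * e (affineRep f P) 1 + e (affineRep f P) 1 * e (affineRep f P) 0) +
        c * e (affineRep f P) 1 * e (affineRep f P) 1 := hconic _ (hmem P hP)
    have h1 : e (affineRep f P) 2 = 1 := by rw [he, apply_affineRep (hf P hP)]
    rw [Set.mem_ofPred_eq, rep_eq_smul_affineRep (hf P hP), map_smul]
    simp only [conicForm, map_add, map_mul, map_pow, MvPolynomial.eval_C, MvPolynomial.eval_X,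
      Pi.smul_apply, smul_eq_mul, h1]
    linear_combination -f P.rep ^ 2 * hP2
  · rw [← hScard]
    exact hSD.card_dvd h2 h0 h10 hy hφ ha hconic htan
end

section
/- In PG(2,q), hyperfocused k-arcs with k ≥ 4 exist if and only if q is even. -/
open scoped LinearAlgebra.Projectivization

variable {F : Type*} [Field F]

/-- The linear form `c ↦ det (a, b, c)`. -/
def tripleForm (a b : Fin 3 → F) : (Fin 3 → F) →ₗ[F] F where
  toFun c := a 0 * (b 1 * c 2 - b 2 * c 1) + a 1 * (b 2 * c 0 - b 0 * c 2)
    + a 2 * (b 0 * c 1 - b 1 * c 0)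
  map_add' u v := by simp only [Pi.add_apply]; ring
  map_smul' t v := by simp only [Pi.smul_apply, smul_eq_mul, RingHom.id_apply]; ring

lemma tripleForm_apply (a b c : Fin 3 → F) :
    tripleForm a b c = a 0 * (b 1 * c 2 - b 2 * c 1) + a 1 * (b 2 * c 0 - b 0 * c 2)
      + a 2 * (b 0 * c 1 - b 1 * c 0) := rfl

lemma tripleForm_rotate (a b c : Fin 3 → F) : tripleForm a b c = tripleForm b c a := by
  simp only [tripleForm_apply]; ring

lemma tripleForm_swap (a b c : Fin 3 → F) : tripleForm a b c = - tripleForm b a c := by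
  simp only [tripleForm_apply]; ring

lemma tripleForm_self_left (a b : Fin 3 → F) : tripleForm a b a = 0 := by
  simp only [tripleForm_apply]; ring

lemma tripleForm_self_right (a b : Fin 3 → F) : tripleForm a b b = 0 := by
  simp only [tripleForm_apply]; ring

lemma tripleForm_self (a b : Fin 3 → F) : tripleForm a a b = 0 := by
  simp only [tripleForm_apply]; ring

lemma linearIndependent_rep_pair {A B : PG2 F} (h : A ≠ B) :
    LinearIndependent F ![A.rep, B.rep] := by
  have hi := Projectivization.independent_iff.1
    ((Projectivization.independent_pair_iff_ne A B).2 h)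
  have he : Projectivization.rep ∘ ![A, B] = ![A.rep, B.rep] := by
    funext i
    fin_cases i <;> rfl
  rwa [he] at hi

lemma tripleForm_rep_ne_zero {A B : PG2 F} (h : A ≠ B) : tripleForm A.rep B.rep ≠ 0 := by
  intro h0
  apply crossProduct_ne_zero_iff_linearIndependent.2 (linearIndependent_rep_pair h)
  have e (i : Fin 3) := LinearMap.congr_fun h0 (Pi.single i 1)
  have e0 := e 0
  have e1 := e 1
  have e2 := e 2
  simp [tripleForm_apply] at e0 e1 e2
  rw [cross_apply]
  funext i
  fin_cases i
  · simp; linear_combination e0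
  · simp; linear_combination e1
  · simp; linear_combination e2

/-- The line defined by a linear form. -/
def zeroLine (f : (Fin 3 → F) →ₗ[F] F) : Set (PG2 F) := {P : PG2 F | f P.rep = 0}

lemma mem_zeroLine {f : (Fin 3 → F) →ₗ[F] F} {P : PG2 F} : P ∈ zeroLine f ↔ f P.rep = 0 :=
  Iff.rfl

lemma isLine_zeroLine {f : (Fin 3 → F) →ₗ[F] F} (hf : f ≠ 0) : IsLine (zeroLine f) :=
  ⟨f, hf, rfl⟩

lemma mk_mem_zeroLine {f : (Fin 3 → F) →ₗ[F] F} {v : Fin 3 → F} (hv : v ≠ 0) :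
    Projectivization.mk F v hv ∈ zeroLine f ↔ f v = 0 := by
  obtain ⟨a, ha⟩ := Projectivization.exists_smul_eq_mk_rep F v hv
  rw [mem_zeroLine, ← ha, Units.smul_def, map_smul, smul_eq_mul, mul_eq_zero]
  simp

lemma IsArc.tripleForm_ne_zero [Finite F] {K : Set (PG2 F)} (hK : IsArc K) {A B C : PG2 F}
    (hA : A ∈ K) (hB : B ∈ K) (hC : C ∈ K) (hAB : A ≠ B) (hAC : A ≠ C) (hBC : B ≠ C) :
    tripleForm A.rep B.rep C.rep ≠ 0 := by
  intro h
  have h2 := hK _ (isLine_zeroLine (tripleForm_rep_ne_zero hAB))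
  exact not_lt.2 h2 ((Set.two_lt_ncard_iff (Set.toFinite _)).2
    ⟨A, B, C, ⟨hA, tripleForm_self_left _ _⟩, ⟨hB, tripleForm_self_right _ _⟩, ⟨hC, h⟩,
      hAB, hAC, hBC⟩)

/-- `X` is the point in which the line joining `A` and `P` meets the line `f = 0`. -/
def IsFocus (f : (Fin 3 → F) →ₗ[F] F) (A P X : PG2 F) : Prop :=
  ∃ c : F, c ≠ 0 ∧ X.rep = c • (f P.rep • A.rep - f A.rep • P.rep)

lemma exists_isFocus (f : (Fin 3 → F) →ₗ[F] F) {A P : PG2 F} (hAP : A ≠ P)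
    (hA : f A.rep ≠ 0) : ∃ X, IsFocus f A P X := by
  have hv : f P.rep • A.rep - f A.rep • P.rep ≠ 0 := by
    intro h
    refine tripleForm_rep_ne_zero hAP (LinearMap.ext fun w => ?_)
    refine (mul_eq_zero.1 (?_ : f A.rep * tripleForm A.rep P.rep w = 0)).resolve_left hA
    have h0 := congrFun h 0
    have h1 := congrFun h 1
    have h2 := congrFun h 2
    simp only [Pi.sub_apply, Pi.smul_apply, smul_eq_mul, Pi.zero_apply] at h0 h1 h2
    rw [tripleForm_apply]
    linear_combination (A.rep 1 * w 2 - A.rep 2 * w 1) * h0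
      + (A.rep 2 * w 0 - A.rep 0 * w 2) * h1 + (A.rep 0 * w 1 - A.rep 1 * w 0) * h2
  obtain ⟨a, ha⟩ := Projectivization.exists_smul_eq_mk_rep F _ hv
  exact ⟨Projectivization.mk F _ hv, a, a.ne_zero, ha.symm⟩

lemma IsFocus.mem_focusSet [Finite F] {f : (Fin 3 → F) →ₗ[F] F} {K : Set (PG2 F)}
    {A P X : PG2 F} (h : IsFocus f A P X) (hAP : A ≠ P) (hA : A ∈ K) (hP : P ∈ K) :
    X ∈ FocusSet K (zeroLine f) := by
  obtain ⟨c, -, hX⟩ := h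
  refine ⟨?_, zeroLine (tripleForm A.rep P.rep),
    ⟨isLine_zeroLine (tripleForm_rep_ne_zero hAP), ?_⟩, ?_⟩
  · rw [mem_zeroLine, hX]
    simp only [map_smul, map_sub, smul_eq_mul]
    ring
  · exact (Set.one_lt_ncard_iff (Set.toFinite _)).2
      ⟨A, P, ⟨hA, tripleForm_self_left _ _⟩, ⟨hP, tripleForm_self_right _ _⟩, hAP⟩
  · rw [mem_zeroLine, hX]
    simp [tripleForm_self_left, tripleForm_self_right]

lemma IsFocus.tripleForm_left {f : (Fin 3 → F) →ₗ[F] F} {A P X : PG2 F}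
    (h : IsFocus f A P X) (hA : f A.rep ≠ 0) :
    ∃ t : F, t ≠ 0 ∧ ∀ v, tripleForm A.rep X.rep v = t * tripleForm A.rep P.rep v := by
  obtain ⟨c, hc, hX⟩ := h
  refine ⟨-(c * f A.rep), neg_ne_zero.2 (mul_ne_zero hc hA), fun v => ?_⟩
  simp only [hX, tripleForm_apply, Pi.smul_apply, Pi.sub_apply, smul_eq_mul]
  ring

lemma exists_focus_map [Finite F] {K : Set (PG2 F)} (hK : IsArc K) (f : (Fin 3 → F) →ₗ[F] F)
    {A : PG2 F} (hAK : A ∈ K) (hA : f A.rep ≠ 0) :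
    ∃ φ : PG2 F → PG2 F, (∀ P ∈ K \ {A}, IsFocus f A P (φ P)) ∧
      Set.MapsTo φ (K \ {A}) (FocusSet K (zeroLine f)) ∧ Set.InjOn φ (K \ {A}) := by
  have h (P : PG2 F) : ∃ X, P ∈ K \ {A} → IsFocus f A P X := by
    by_cases hP : P ∈ K \ {A}
    · obtain ⟨X, hX⟩ := exists_isFocus f (Ne.symm hP.2) hA
      exact ⟨X, fun _ => hX⟩
    · exact ⟨A, fun h => absurd h hP⟩
  choose φ hφ using h
  refine ⟨φ, hφ, fun P hP => (hφ P hP).mem_focusSet (Ne.symm hP.2) hAK hP.1, ?_⟩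
  intro P hP Q hQ hPQ
  by_contra hne
  obtain ⟨t, ht, h1⟩ := (hφ P hP).tripleForm_left hA
  obtain ⟨s, -, h2⟩ := (hφ Q hQ).tripleForm_left hA
  have h3 := h1 Q.rep
  rw [hPQ, h2, tripleForm_self_right, mul_zero] at h3
  exact mul_ne_zero ht
    (hK.tripleForm_ne_zero hAK hP.1 hQ.1 (Ne.symm hP.2) (Ne.symm hQ.2) hne) h3.symm

lemma ncard_sub_one_le_ncard_focusSet [Finite F] {K : Set (PG2 F)} (hK : IsArc K)
    {f : (Fin 3 → F) →ₗ[F] F} {A : PG2 F} (hAK : A ∈ K) (hA : f A.rep ≠ 0) :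
    K.ncard - 1 ≤ (FocusSet K (zeroLine f)).ncard := by
  obtain ⟨φ, -, hmaps, hinj⟩ := exists_focus_map hK f hAK hA
  rw [← Set.ncard_sdiff_singleton_of_mem hAK]
  exact Set.ncard_le_ncard_of_injOn φ hmaps hinj (Set.toFinite _)

lemma exists_focus_surjOn [Finite F] {K : Set (PG2 F)} (hK : IsArc K)
    {f : (Fin 3 → F) →ₗ[F] F} (hcard : (FocusSet K (zeroLine f)).ncard = K.ncard - 1)
    {A : PG2 F} (hAK : A ∈ K) (hA : f A.rep ≠ 0) :
    ∃ φ : PG2 F → PG2 F, (∀ P ∈ K \ {A}, IsFocus f A P (φ P)) ∧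
      φ '' (K \ {A}) = FocusSet K (zeroLine f) ∧ Set.InjOn φ (K \ {A}) := by
  obtain ⟨φ, hφ, hmaps, hinj⟩ := exists_focus_map hK f hAK hA
  refine ⟨φ, hφ, Set.eq_of_subset_of_ncard_le hmaps.image_subset ?_ (Set.toFinite _), hinj⟩
  rw [hinj.ncard_image, Set.ncard_sdiff_singleton_of_mem hAK, hcard]

/-- A field element, with zero replaced by one. -/
noncomputable def zeroToOne (x : F) : F := by
  classical exact if x = 0 then 1 else x

lemma zeroToOne_zero : zeroToOne (0 : F) = 1 := by simp [zeroToOne]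

lemma zeroToOne_of_ne {x : F} (hx : x ≠ 0) : zeroToOne x = x := by simp [zeroToOne, hx]

/-- The coordinate of the line `AX` in the pencil of lines through `A`, normalized by the lines
`AB` and `AC`. -/
noncomputable def pencilRatio (A B C X : PG2 F) : F :=
  zeroToOne (tripleForm A.rep X.rep C.rep / tripleForm B.rep X.rep A.rep)

/-- The product of the coordinates of the lines joining `X` to the vertices of a triangle. -/
noncomputable def cevaProduct (A B C X : PG2 F) : F :=
  pencilRatio A B C X * pencilRatio B C A X * pencilRatio C A B X

lemma cevaProduct_eq_one {A B C X : PG2 F} (hA : tripleForm A.rep X.rep C.rep ≠ 0)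
    (hB : tripleForm B.rep X.rep A.rep ≠ 0) (hC : tripleForm C.rep X.rep B.rep ≠ 0) :
    cevaProduct A B C X = 1 := by
  rw [cevaProduct, pencilRatio, pencilRatio, pencilRatio, zeroToOne_of_ne (div_ne_zero hA hB),
    zeroToOne_of_ne (div_ne_zero hB hC), zeroToOne_of_ne (div_ne_zero hC hA)]
  field_simp

lemma cevaProduct_rotate (A B C X : PG2 F) : cevaProduct A B C X = cevaProduct B C A X := by
  simp only [cevaProduct]; ring

lemma cevaProduct_vertex (A B C : PG2 F) : cevaProduct A B C A = 1 := by
  simp [cevaProduct, pencilRatio, tripleForm_self, tripleForm_self_right, zeroToOne_zero]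

lemma cevaProduct_of_isFocus {f : (Fin 3 → F) →ₗ[F] F} {A B C X : PG2 F}
    (h : IsFocus f A B X) (hA : f A.rep ≠ 0) (hB : f B.rep ≠ 0)
    (hABC : tripleForm A.rep B.rep C.rep ≠ 0) :
    cevaProduct A B C X = - (f B.rep / f A.rep) := by
  obtain ⟨c, hc, hX⟩ := h
  have h1 : tripleForm B.rep X.rep A.rep = 0 := by
    simp only [hX, tripleForm_apply, Pi.smul_apply, Pi.sub_apply, smul_eq_mul]; ring
  have h2 : tripleForm A.rep X.rep C.rep = -(c * f A.rep * tripleForm A.rep B.rep C.rep) := by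
    simp only [hX, tripleForm_apply, Pi.smul_apply, Pi.sub_apply, smul_eq_mul]; ring
  have h3 : tripleForm C.rep X.rep B.rep = c * f B.rep * tripleForm A.rep B.rep C.rep := by
    simp only [hX, tripleForm_apply, Pi.smul_apply, Pi.sub_apply, smul_eq_mul]; ring
  have h4 : tripleForm C.rep X.rep B.rep / tripleForm A.rep X.rep C.rep
      = - (f B.rep / f A.rep) := by
    rw [h2, h3]; field_simp
  rw [cevaProduct, pencilRatio, pencilRatio, pencilRatio, h1, h4, div_zero, zero_div,
    zeroToOne_zero, zeroToOne_of_ne (neg_ne_zero.2 (div_ne_zero hB hA))]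
  ring

lemma IsFocus.symm {f : (Fin 3 → F) →ₗ[F] F} {A P X : PG2 F} (h : IsFocus f A P X) :
    IsFocus f P A X := by
  obtain ⟨c, hc, hX⟩ := h
  exact ⟨-c, neg_ne_zero.2 hc, by rw [hX]; module⟩

lemma IsFocus.pencilRatio_eq {f : (Fin 3 → F) →ₗ[F] F} {A P X : PG2 F}
    (h : IsFocus f A P X) (hA : f A.rep ≠ 0) (B C : PG2 F) :
    pencilRatio A B C X = pencilRatio A B C P := by
  obtain ⟨t, ht, h1⟩ := h.tripleForm_left hA
  have h2 : tripleForm B.rep X.rep A.rep = t * tripleForm B.rep P.rep A.rep := by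
    have := h1 B.rep
    rw [tripleForm_rotate B.rep, tripleForm_rotate B.rep, tripleForm_swap X.rep,
      tripleForm_swap P.rep, this, mul_neg]
  rw [pencilRatio, pencilRatio, h1, h2, mul_div_mul_left _ _ ht]

lemma finprod_pencilRatio [Finite F] {K : Set (PG2 F)} (hK : IsArc K)
    {f : (Fin 3 → F) →ₗ[F] F} (hcard : (FocusSet K (zeroLine f)).ncard = K.ncard - 1)
    {A : PG2 F} (hAK : A ∈ K) (hA : f A.rep ≠ 0) (B C : PG2 F) :
    ∏ᶠ P ∈ K, pencilRatio A B C P = ∏ᶠ X ∈ FocusSet K (zeroLine f), pencilRatio A B C X := by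
  obtain ⟨φ, hφ, him, hinj⟩ := exists_focus_surjOn hK hcard hAK hA
  have h1 : pencilRatio A B C A = 1 := by
    simp [pencilRatio, tripleForm_self_right, zeroToOne_zero]
  have h2 : ∏ᶠ P ∈ K, pencilRatio A B C P = ∏ᶠ P ∈ K \ {A}, pencilRatio A B C P := by
    conv_lhs => rw [← Set.insert_sdiff_self_of_mem hAK]
    exact finprod_mem_insert_of_eq_one_if_notMem fun _ => h1
  rw [← him, finprod_mem_image hinj, h2]
  exact finprod_mem_congr rfl fun P hP => ((hφ P hP).pencilRatio_eq hA B C).symm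

lemma eq_of_mem_focusSet [Finite F] {K : Set (PG2 F)} (hK : IsArc K)
    {f : (Fin 3 → F) →ₗ[F] F} (hcard : (FocusSet K (zeroLine f)).ncard = K.ncard - 1)
    {A B X Y : PG2 F} (hAK : A ∈ K) (hBK : B ∈ K) (hAB : A ≠ B) (hA : f A.rep ≠ 0)
    (hX : X ∈ FocusSet K (zeroLine f)) (h : tripleForm A.rep X.rep B.rep = 0)
    (hY : IsFocus f A B Y) : X = Y := by
  obtain ⟨φ, hφ, him, -⟩ := exists_focus_surjOn hK hcard hAK hA
  have key {Z : PG2 F} (hZ : Z ∈ FocusSet K (zeroLine f))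
      (h : tripleForm A.rep Z.rep B.rep = 0) : Z = φ B := by
    rw [← him] at hZ
    obtain ⟨P, hP, rfl⟩ := hZ
    obtain ⟨t, ht, h1⟩ := (hφ P hP).tripleForm_left hA
    rw [h1] at h
    by_contra hne
    exact hK.tripleForm_ne_zero hAK hP.1 hBK (Ne.symm hP.2) hAB (fun e => hne (by rw [e]))
      ((mul_eq_zero.1 h).resolve_left ht)
  rw [key hX h, key (hY.mem_focusSet hAB hAK hBK)]
  obtain ⟨t, -, h1⟩ := hY.tripleForm_left hA
  rw [h1, tripleForm_self_right, mul_zero]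

lemma IsFocus.ne {f : (Fin 3 → F) →ₗ[F] F} {A B C X Y : PG2 F} (hX : IsFocus f A B X)
    (hY : IsFocus f A C Y) (hA : f A.rep ≠ 0) (h : tripleForm A.rep B.rep C.rep ≠ 0) :
    X ≠ Y := by
  rintro rfl
  obtain ⟨t, ht, h1⟩ := hX.tripleForm_left hA
  obtain ⟨s, -, h2⟩ := hY.tripleForm_left hA
  have h3 := h1 C.rep
  rw [h2, tripleForm_self_right, mul_zero] at h3
  exact mul_ne_zero ht h h3.symm

theorem two_eq_zero_of_hyperfocused [Finite F] {K l : Set (PG2 F)} (hK : IsArc K)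
    (h3 : 3 ≤ K.ncard) (h : Hyperfocused K l) : (2 : F) = 0 := by
  obtain ⟨⟨f, hf, rfl⟩, hdisj, hcard⟩ := h
  change (FocusSet K (zeroLine f)).ncard = K.ncard - 1 at hcard
  have hext {P : PG2 F} (hP : P ∈ K) : f P.rep ≠ 0 := fun h0 =>
    (Set.eq_empty_iff_forall_notMem.1 hdisj) P ⟨hP, h0⟩
  obtain ⟨A, B, C, hA, hB, hC, hAB, hAC, hBC⟩ := (Set.two_lt_ncard_iff (Set.toFinite _)).1 h3
  have hABC := hK.tripleForm_ne_zero hA hB hC hAB hAC hBC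
  have hBCA : tripleForm B.rep C.rep A.rep ≠ 0 := by rwa [← tripleForm_rotate]
  have hCAB : tripleForm C.rep A.rep B.rep ≠ 0 := by rwa [← tripleForm_rotate]
  obtain ⟨X, hX⟩ := exists_isFocus f hAB (hext hA)
  obtain ⟨Y, hY⟩ := exists_isFocus f hBC (hext hB)
  obtain ⟨Z, hZ⟩ := exists_isFocus f hAC.symm (hext hC)
  have hXY : X ≠ Y := (hY.ne hX.symm (hext hB) hBCA).symm
  have hYZ : Y ≠ Z := (hZ.ne hY.symm (hext hC) hCAB).symm
  have hXZ : X ≠ Z := hX.ne hZ.symm (hext hA) hABC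
  have hprod : ∏ᶠ P ∈ K, cevaProduct A B C P
      = ∏ᶠ P ∈ FocusSet K (zeroLine f), cevaProduct A B C P := by
    simp only [cevaProduct]
    rw [finprod_mem_mul_distrib (Set.toFinite _), finprod_mem_mul_distrib (Set.toFinite _),
      finprod_mem_mul_distrib (Set.toFinite _), finprod_mem_mul_distrib (Set.toFinite _),
      finprod_pencilRatio hK hcard hA (hext hA), finprod_pencilRatio hK hcard hB (hext hB),
      finprod_pencilRatio hK hcard hC (hext hC)]
  have hone : ∏ᶠ P ∈ K, cevaProduct A B C P = 1 := by
    refine finprod_mem_eq_one_of_forall_eq_one fun P hP => ?_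
    by_cases hPA : P = A
    · rw [hPA, cevaProduct_vertex]
    by_cases hPB : P = B
    · rw [hPB, cevaProduct_rotate, cevaProduct_vertex]
    by_cases hPC : P = C
    · rw [hPC, cevaProduct_rotate, cevaProduct_rotate, cevaProduct_vertex]
    exact cevaProduct_eq_one
      (hK.tripleForm_ne_zero hA hP hC (Ne.symm hPA) hAC hPC)
      (hK.tripleForm_ne_zero hB hP hA (Ne.symm hPB) hAB.symm hPA)
      (hK.tripleForm_ne_zero hC hP hB (Ne.symm hPC) hBC.symm hPB)
  have hXYZ : ∏ᶠ P ∈ FocusSet K (zeroLine f), cevaProduct A B C P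
      = ∏ᶠ P ∈ ({X, Y, Z} : Set (PG2 F)), cevaProduct A B C P := by
    refine finprod_mem_inter_mulSupport_eq' _ _ _ fun P hP => ⟨fun hPF => ?_, ?_⟩
    · by_contra hne
      simp only [Set.mem_insert_iff, Set.mem_singleton_iff, not_or] at hne
      refine hP (cevaProduct_eq_one (fun h0 => hne.2.2 ?_) (fun h0 => hne.1 ?_)
        (fun h0 => hne.2.1 ?_))
      · exact eq_of_mem_focusSet hK hcard hA hC hAC (hext hA) hPF h0 hZ.symm
      · exact eq_of_mem_focusSet hK hcard hB hA hAB.symm (hext hB) hPF h0 hX.symm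
      · exact eq_of_mem_focusSet hK hcard hC hB hBC.symm (hext hC) hPF h0 hY.symm
    · rintro (rfl | rfl | rfl)
      · exact hX.mem_focusSet hAB hA hB
      · exact hY.mem_focusSet hBC hB hC
      · exact hZ.mem_focusSet hAC.symm hC hA
  rw [hone, hXYZ, finprod_mem_insert _ (by simp [hXY, hXZ]) (Set.toFinite _),
    finprod_mem_pair hYZ, cevaProduct_of_isFocus hX (hext hA) (hext hB) hABC,
    cevaProduct_rotate, cevaProduct_of_isFocus hY (hext hB) (hext hC) hBCA,
    cevaProduct_rotate A, cevaProduct_rotate B,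
    cevaProduct_of_isFocus hZ (hext hC) (hext hA) hCAB] at hprod
  have := hext hA
  have := hext hB
  have := hext hC
  field_simp at hprod
  linear_combination hprod

lemma card_even_of_two_eq_zero [Fintype F] (h : (2 : F) = 0) : Even (Fintype.card F) := by
  rw [Nat.even_iff, ← FiniteField.even_card_iff_char_two]
  have := CharTwo.of_one_ne_zero_of_two_eq_zero (one_ne_zero (α := F)) h
  exact ringChar.eq_iff.2 this

lemma two_eq_zero_of_card_even [Fintype F] (h : Even (Fintype.card F)) : (2 : F) = 0 := by
  rw [Nat.even_iff, ← FiniteField.even_card_iff_char_two] at h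
  have := ringChar.Nat.cast_ringChar (R := F)
  rw [h] at this
  exact_mod_cast this

/-- The point with affine coordinates `(x, y)`. -/
def affinePt (x y : F) : PG2 F := pt x y 1 (mk3_ne_zero (by simp))

/-- The four affine points with coordinates zero or one. -/
def unitSquare (F : Type*) [Field F] : Set (PG2 F) :=
  {affinePt 0 0, affinePt 1 0, affinePt 0 1, affinePt 1 1}

lemma form_apply (f : (Fin 3 → F) →ₗ[F] F) (v : Fin 3 → F) :
    f v = v 0 * f (Pi.single 0 1) + v 1 * f (Pi.single 1 1) + v 2 * f (Pi.single 2 1) := by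
  conv_lhs => rw [← Finset.univ_sum_single v]
  rw [map_sum, Fin.sum_univ_three]
  have (i : Fin 3) : f (Pi.single i (v i)) = v i * f (Pi.single i 1) := by
    rw [← smul_eq_mul, ← map_smul, ← Pi.single_smul, smul_eq_mul, mul_one]
  simp only [this]

lemma form_eq_zero {f : (Fin 3 → F) →ₗ[F] F} (h0 : f (Pi.single 0 1) = 0)
    (h1 : f (Pi.single 1 1) = 0) (h2 : f (Pi.single 2 1) = 0) : f = 0 := by
  refine LinearMap.ext fun v => ?_
  rw [form_apply, h0, h1, h2]
  simp

lemma affinePt_mem_zeroLine {f : (Fin 3 → F) →ₗ[F] F} {x y : F} :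
    affinePt x y ∈ zeroLine f ↔
      x * f (Pi.single 0 1) + y * f (Pi.single 1 1) + f (Pi.single 2 1) = 0 := by
  rw [affinePt, pt, mk_mem_zeroLine, form_apply]
  simp

lemma affinePt_inj {x y x' y' : F} : affinePt x y = affinePt x' y' ↔ x = x' ∧ y = y' := by
  constructor
  · intro h
    obtain ⟨a, ha⟩ := (Projectivization.mk_eq_mk_iff' ..).1 h
    have h0 := congrFun ha 0
    have h1 := congrFun ha 1
    have h2 := congrFun ha 2
    simp at h0 h1 h2
    subst h2
    simp at h0 h1
    exact ⟨h0.symm, h1.symm⟩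
  · rintro ⟨rfl, rfl⟩
    rfl

lemma ncard_unitSquare : (unitSquare F).ncard = 4 := by
  rw [unitSquare, Set.ncard_insert_of_notMem, Set.ncard_insert_of_notMem, Set.ncard_pair]
  all_goals simp [affinePt_inj]

lemma isArc_unitSquare [Finite F] (h2 : (2 : F) = 0) : IsArc (unitSquare F) := by
  rintro l ⟨f, hf, rfl⟩
  change (unitSquare F ∩ zeroLine f).ncard ≤ 2
  by_contra! h
  obtain ⟨A, B, C, ⟨hA, hA'⟩, ⟨hB, hB'⟩, ⟨hC, hC'⟩, hAB, hAC, hBC⟩ :=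
    (Set.two_lt_ncard_iff (Set.toFinite _)).1 h
  apply hf
  rcases hA with rfl | rfl | rfl | rfl <;> rcases hB with rfl | rfl | rfl | rfl <;>
    first
    | exact absurd rfl hAB
    | rcases hC with rfl | rfl | rfl | rfl <;>
      first
      | exact absurd rfl hAC
      | exact absurd rfl hBC
      | (rw [affinePt_mem_zeroLine] at hA' hB' hC'
         apply form_eq_zero <;> grind)

/-- The line at infinity. -/
def lineAtInfinity (F : Type*) [Field F] : Set (PG2 F) := zeroLine (LinearMap.proj 2)

lemma eq_pt_of_mem_lineAtInfinity {P : PG2 F} (hP : P ∈ lineAtInfinity F) {a b : F}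
    (h : ![a, b, 0] ≠ 0) (hab : a * P.rep 1 = b * P.rep 0) : P = pt a b 0 h := by
  have h2 : P.rep 2 = 0 := hP
  rw [← P.mk_rep, pt, Projectivization.mk_eq_mk_iff']
  by_cases ha : a = 0
  · subst ha
    have hb : b ≠ 0 := by rintro rfl; simp at h
    refine ⟨P.rep 1 / b, ?_⟩
    funext i
    fin_cases i <;> simp [h2] <;> grind
  · refine ⟨P.rep 0 / a, ?_⟩
    funext i
    fin_cases i <;> simp [h2] <;> grind

lemma focusSet_unitSquare_subset [Finite F] (h2 : (2 : F) = 0) :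
    FocusSet (unitSquare F) (lineAtInfinity F) ⊆
      {pt 1 0 0 (mk3_ne_zero (by simp)), pt 0 1 0 (mk3_ne_zero (by simp)),
        pt 1 1 0 (mk3_ne_zero (by simp))} := by
  rintro P ⟨hP, m, ⟨⟨f, hf, rfl⟩, hm⟩, hPm⟩
  change 2 ≤ (unitSquare F ∩ zeroLine f).ncard at hm
  obtain ⟨A, B, ⟨hA, hA'⟩, ⟨hB, hB'⟩, hAB⟩ := (Set.one_lt_ncard_iff (Set.toFinite _)).1 hm
  have hP2 : P.rep 2 = 0 := hP
  change f P.rep = 0 at hPm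
  rw [form_apply, hP2] at hPm
  have hf' : ¬ (f (Pi.single 0 1) = 0 ∧ f (Pi.single 1 1) = 0 ∧ f (Pi.single 2 1) = 0) :=
    fun h => hf (form_eq_zero h.1 h.2.1 h.2.2)
  suffices h : P.rep 1 = 0 ∨ P.rep 0 = 0 ∨ P.rep 1 = P.rep 0 by
    rcases h with h | h | h
    · exact Or.inl (eq_pt_of_mem_lineAtInfinity hP _ (by simp [h]))
    · exact Or.inr (Or.inl (eq_pt_of_mem_lineAtInfinity hP _ (by simp [h])))
    · exact Or.inr (Or.inr (eq_pt_of_mem_lineAtInfinity hP _ (by simp [h])))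
  rcases hA with rfl | rfl | rfl | rfl <;> rcases hB with rfl | rfl | rfl | rfl <;>
    first
    | exact absurd rfl hAB
    | (rw [affinePt_mem_zeroLine] at hA' hB'; grind)

lemma disjoint_unitSquare_lineAtInfinity : unitSquare F ∩ lineAtInfinity F = ∅ := by
  rw [Set.eq_empty_iff_forall_notMem]
  rintro P ⟨rfl | rfl | rfl | rfl, h⟩ <;>
    simp [lineAtInfinity, affinePt_mem_zeroLine] at h

lemma hyperfocused_unitSquare [Finite F] (h2 : (2 : F) = 0) :
    Hyperfocused (unitSquare F) (lineAtInfinity F) := by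
  refine ⟨isLine_zeroLine fun h => ?_, disjoint_unitSquare_lineAtInfinity, le_antisymm ?_ ?_⟩
  · simpa using LinearMap.congr_fun h (Pi.single 2 1)
  · rw [ncard_unitSquare]
    refine (Set.ncard_le_ncard (focusSet_unitSquare_subset h2) (Set.toFinite _)).trans ?_
    refine (Set.ncard_insert_le _ _).trans (Nat.succ_le_succ ?_)
    refine (Set.ncard_insert_le _ _).trans (Nat.succ_le_succ ?_)
    simp
  · have hmem : affinePt 0 0 ∈ unitSquare F := Or.inl rfl
    refine ncard_sub_one_le_ncard_focusSet (isArc_unitSquare h2) hmem fun h => ?_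
    exact (Set.eq_empty_iff_forall_notMem.1 disjoint_unitSquare_lineAtInfinity) _ ⟨hmem, h⟩

/-- Bichara–Korchmáros: hyperfocused `k`-arcs with `k ≥ 4`
exist in `PG(2,q)` if and only if `q` is even. -/
theorem exists_hyperfocused_iff_even (F : Type*) [Field F] [Fintype F] :
    (∃ (K l : Set (PG2 F)) (k : ℕ), 4 ≤ k ∧ IsArc K ∧ K.ncard = k ∧
      Hyperfocused K l) ↔ Even (Fintype.card F) := by
  constructor
  · rintro ⟨K, l, k, hk, hK, rfl, h⟩
    exact card_even_of_two_eq_zero (two_eq_zero_of_hyperfocused hK (by omega) h)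
  · intro h
    have h2 := two_eq_zero_of_card_even h
    exact ⟨unitSquare F, lineAtInfinity F, 4, le_rfl, isArc_unitSquare h2, ncard_unitSquare,
      hyperfocused_unitSquare h2⟩
end
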